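/- arXiv:2508.11448 — 4 statements merged into one kernel-verified Lean document; each statement's English description precedes it below -/
import Mathlib

section
/- Let V be an irreducible cuspidal Harish-Chandra module over τ(B), and let 𝔐_1, 𝔐_2 be two comaximal (coprime) ideals of B, i.e. 𝔐_1 + 𝔐_2 = B, such that (τ ⊗ 𝔐_1𝔐_2)·V = 0. Then either (τ ⊗ 𝔐_1)·V = 0 or (τ ⊗ 𝔐_2)·V = 0. -/
open scoped TensorProduct

namespace MT

/-- Presentation of the full toroidal Lie algebra `τ` of rank `n` associated with the
finite-dimensional simple complex Lie algebra `𝔤`, the invariant form `κ` and the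
2-cocycle `φ = c₁ • φ₁ + c₂ • φ₂`.  Here `E m x` stands for `x ⊗ t^m`, `K m i` for
`t^m K_i` (the image in the space of Kähler differentials `𝒦 = Ω/dA_n`), and
`W m i` for `t^m d_i`. -/
structure IsFullToroidal (n : ℕ) (𝔤 : Type) [LieRing 𝔤] [LieAlgebra ℂ 𝔤]
    (τ : Type) [LieRing τ] [LieAlgebra ℂ τ]
    (κ : 𝔤 →ₗ[ℂ] 𝔤 →ₗ[ℂ] ℂ) (c₁ c₂ : ℂ)
    (E : (Fin n → ℤ) → 𝔤 →ₗ[ℂ] τ) (K W : (Fin n → ℤ) → Fin n → τ) : Prop where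
  κ_symm : ∀ x y, κ x y = κ y x
  κ_invariant : ∀ x y z, κ ⁅x, y⁆ z = κ x ⁅y, z⁆
  κ_nondeg : ∀ x, (∀ y, κ x y = 0) → x = 0
  span_eq_top : Submodule.span ℂ
      ({z : τ | ∃ m x, z = E m x} ∪ {z : τ | ∃ m i, z = K m i} ∪
        {z : τ | ∃ m i, z = W m i}) = ⊤
  K_rel : ∀ m : Fin n → ℤ, (∑ i, (m i : ℂ) • K m i) = 0
  lie_E_E : ∀ m k x y, ⁅E m x, E k y⁆
      = E (m + k) ⁅x, y⁆ + κ x y • ∑ i, (m i : ℂ) • K (m + k) i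
  lie_E_K : ∀ m x k j, ⁅E m x, K k j⁆ = 0
  lie_K_K : ∀ m i k j, ⁅K m i, K k j⁆ = 0
  lie_W_E : ∀ m i k x, ⁅W m i, E k x⁆ = (k i : ℂ) • E (m + k) x
  lie_W_K : ∀ m i k j, ⁅W m i, K k j⁆
      = (k i : ℂ) • K (m + k) j + (if i = j then ∑ p, (m p : ℂ) • K (m + k) p else 0)
  lie_W_W : ∀ m i k j, ⁅W m i, W k j⁆
      = (k i : ℂ) • W (m + k) j - (m j : ℂ) • W (m + k) i
        + (c₁ * (-((k i : ℂ) * (m j : ℂ))) + c₂ * ((m i : ℂ) * (k j : ℂ)))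
          • ∑ p, (m p : ℂ) • K (m + k) p

/-- The map algebra `τ(B) = τ ⊗ B` is a complex Lie algebra. -/
noncomputable instance mapLieAlgebra (B τ : Type) [CommRing B] [Algebra ℂ B]
    [LieRing τ] [LieAlgebra ℂ τ] : LieAlgebra ℂ (B ⊗[ℂ] τ) :=
  { (inferInstance : Module ℂ (B ⊗[ℂ] τ)) with
    lie_smul := fun c x y => by
      rw [← algebraMap_smul B c y, lie_smul, algebraMap_smul] }

/-- The simultaneous eigenspace ("weight space") of the commuting family of
operators `d` for the eigenvalue function `l`. -/
def weightSpace {n : ℕ} {L V : Type*} [LieRing L] [LieAlgebra ℂ L] [AddCommGroup V]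
    [Module ℂ V] [LieRingModule L V] [LieModule ℂ L V]
    (d : Fin n → L) (l : Fin n → ℂ) : Submodule ℂ V where
  carrier := {v | ∀ i, ⁅d i, v⁆ = l i • v}
  add_mem' := by
    intro a b ha hb i
    rw [lie_add, ha i, hb i, smul_add]
  zero_mem' := by
    intro i
    rw [lie_zero, smul_zero]
  smul_mem' := by
    intro c a ha i
    rw [lie_smul, ha i, smul_comm]

/-- `V` is a Harish-Chandra module with respect to the degree operators `d`:
the sum of the weight spaces is all of `V` and each weight space is finite
dimensional. -/
def IsHarishChandra {n : ℕ} {L V : Type*} [LieRing L] [LieAlgebra ℂ L] [AddCommGroup V]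
    [Module ℂ V] [LieRingModule L V] [LieModule ℂ L V] (d : Fin n → L) : Prop :=
  (⨆ l : Fin n → ℂ, weightSpace (V := V) d l) = ⊤ ∧
    ∀ l : Fin n → ℂ, FiniteDimensional ℂ (weightSpace (V := V) d l)

/-- `V` is cuspidal (uniformly bounded): a Harish-Chandra module whose weight
space dimensions admit a uniform bound. -/
def IsCuspidal {n : ℕ} {L V : Type*} [LieRing L] [LieAlgebra ℂ L] [AddCommGroup V]
    [Module ℂ V] [LieRingModule L V] [LieModule ℂ L V] (d : Fin n → L) : Prop :=
  IsHarishChandra (V := V) d ∧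
    ∃ N : ℕ, ∀ l : Fin n → ℂ, Module.finrank ℂ (weightSpace (V := V) d l) ≤ N

/-- The degree operators `d_i ⊗ 1` inside `τ(B)`. -/
noncomputable def dOp {n : ℕ} (B : Type) [CommRing B] [Algebra ℂ B] {τ : Type}
    [LieRing τ] [LieAlgebra ℂ τ] (W : (Fin n → ℤ) → Fin n → τ) (i : Fin n) :
    B ⊗[ℂ] τ :=
  (1 : B) ⊗ₜ[ℂ] W 0 i

variable {n : ℕ} {𝔤 : Type} [LieRing 𝔤] [LieAlgebra ℂ 𝔤]
variable {τ : Type} [LieRing τ] [LieAlgebra ℂ τ]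

/-- The set of homogeneous generators of `τ` of degree `m`. -/
def genOfDeg (E : (Fin n → ℤ) → 𝔤 →ₗ[ℂ] τ) (K W : (Fin n → ℤ) → Fin n → τ)
    (m : Fin n → ℤ) : Set τ :=
  Set.range (E m) ∪ Set.range (K m) ∪ Set.range (W m)

/-- The homogeneous generators of `τ` of degree lying in the subgroup `M`,
i.e. generators of `τ_M`. -/
def tauMGens (E : (Fin n → ℤ) → 𝔤 →ₗ[ℂ] τ) (K W : (Fin n → ℤ) → Fin n → τ)
    (M : AddSubgroup (Fin n → ℤ)) : Set τ :=
  {Y | ∃ m ∈ M, Y ∈ genOfDeg E K W m}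

/-- The graded piece `τ_m`. -/
def gradedPiece (E : (Fin n → ℤ) → 𝔤 →ₗ[ℂ] τ) (K W : (Fin n → ℤ) → Fin n → τ)
    (m : Fin n → ℤ) : Submodule ℂ τ :=
  Submodule.span ℂ (genOfDeg E K W m)

/-- The subalgebra `τ(B)_M = ⊕_{m ∈ M} τ_m ⊗ B` of `τ(B)`. -/
noncomputable def tauBM (B : Type) [CommRing B] [Algebra ℂ B]
    (E : (Fin n → ℤ) → 𝔤 →ₗ[ℂ] τ) (K W : (Fin n → ℤ) → Fin n → τ)
    (M : AddSubgroup (Fin n → ℤ)) : LieSubalgebra ℂ (B ⊗[ℂ] τ) :=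
  LieSubalgebra.lieSpan ℂ (B ⊗[ℂ] τ)
    {z | ∃ (a : B) (Y : τ), Y ∈ tauMGens E K W M ∧ z = a ⊗ₜ[ℂ] Y}

/-- The degree operators `d_i ⊗ 1` as elements of `τ(B)_M` (note `0 ∈ M`). -/
noncomputable def dOpM (B : Type) [CommRing B] [Algebra ℂ B]
    (E : (Fin n → ℤ) → 𝔤 →ₗ[ℂ] τ) (K W : (Fin n → ℤ) → Fin n → τ)
    (M : AddSubgroup (Fin n → ℤ)) (i : Fin n) : ↥(tauBM B E K W M) :=
  ⟨(1 : B) ⊗ₜ[ℂ] W 0 i,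
    LieSubalgebra.subset_lieSpan
      ⟨1, W 0 i, ⟨0, M.zero_mem, Or.inr ⟨i, rfl⟩⟩, rfl⟩⟩

/-- `(τ ⊗ I)·V = 0`. -/
def annTensor (τ : Type) [LieRing τ] [LieAlgebra ℂ τ] (B : Type) [CommRing B]
    [Algebra ℂ B] (I : Ideal B) (V : Type) [AddCommGroup V] [Module ℂ V]
    [LieRingModule (B ⊗[ℂ] τ) V] : Prop :=
  ∀ X : τ, ∀ a ∈ I, ∀ v : V, ⁅a ⊗ₜ[ℂ] X, v⁆ = 0

/-- The action of `τ(B)` on `V` is by evaluation at the algebra homomorphism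
`ψ : B → ℂ`:  `(X ⊗ b)·v = ψ(b) (X ⊗ 1)·v`. -/
def evalActs (τ : Type) [LieRing τ] [LieAlgebra ℂ τ] (B : Type) [CommRing B]
    [Algebra ℂ B] (ψ : B →ₐ[ℂ] ℂ) (V : Type) [AddCommGroup V] [Module ℂ V]
    [LieRingModule (B ⊗[ℂ] τ) V] : Prop :=
  ∀ (X : τ) (b : B) (v : V), ⁅b ⊗ₜ[ℂ] X, v⁆ = ψ b • ⁅(1 : B) ⊗ₜ[ℂ] X, v⁆

/-- `v` is annihilated by `τ(B)^+_M = ⊕_{m ∈ M, r ≥ 1} τ(B)_{m + rβ}`. -/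
def annPlus (B : Type) [CommRing B] [Algebra ℂ B]
    (E : (Fin n → ℤ) → 𝔤 →ₗ[ℂ] τ) (K W : (Fin n → ℤ) → Fin n → τ)
    (M : AddSubgroup (Fin n → ℤ)) (β : Fin n → ℤ) {V : Type} [AddCommGroup V]
    [Module ℂ V] [LieRingModule (B ⊗[ℂ] τ) V] (v : V) : Prop :=
  ∀ m₀ ∈ M, ∀ r : ℕ, 0 < r → ∀ a : B,
    (∀ x : 𝔤, ⁅a ⊗ₜ[ℂ] E (m₀ + (r : ℤ) • β) x, v⁆ = 0) ∧
    (∀ i : Fin n, ⁅a ⊗ₜ[ℂ] K (m₀ + (r : ℤ) • β) i, v⁆ = 0) ∧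
    (∀ i : Fin n, ⁅a ⊗ₜ[ℂ] W (m₀ + (r : ℤ) • β) i, v⁆ = 0)

/-- Successive action of a list of Lie algebra elements on a module vector:
`actList [x₁, …, x_r] v = x₁ · (x₂ ⋯ (x_r · v))`. -/
def actList {L V : Type*} [LieRing L] [AddCommGroup V] [LieRingModule L V] :
    List L → V → V
  | [], v => v
  | x :: xs, v => ⁅x, actList xs v⁆

/-- `V` is a highest weight module for `τ(B)`:  there are `M ≤ ℤⁿ` and `β ∈ ℤⁿ`
with `ℤⁿ = M ⊕ ℤβ` and a nonzero `v ∈ V` with `τ(B)^+_M · v = 0` which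
generates `V` over `U(τ(B))`. -/
def IsHighestWeightModule (B : Type) [CommRing B] [Algebra ℂ B]
    (E : (Fin n → ℤ) → 𝔤 →ₗ[ℂ] τ) (K W : (Fin n → ℤ) → Fin n → τ)
    (V : Type) [AddCommGroup V] [Module ℂ V] [LieRingModule (B ⊗[ℂ] τ) V]
    [LieModule ℂ (B ⊗[ℂ] τ) V] : Prop :=
  ∃ (M : AddSubgroup (Fin n → ℤ)) (β : Fin n → ℤ),
    IsCompl M (AddSubgroup.zmultiples β) ∧
    ∃ v : V, v ≠ 0 ∧ annPlus B E K W M β v ∧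
      LieSubmodule.lieSpan ℂ (B ⊗[ℂ] τ) {v} = ⊤

/-- Linear independence properties of the generators of the full toroidal Lie
algebra: the only linear relations among the homogeneous generators are the
Kähler relations `∑ᵢ mᵢ t^m K_i = 0`. -/
structure FreeGens (E : (Fin n → ℤ) → 𝔤 →ₗ[ℂ] τ) (K W : (Fin n → ℤ) → Fin n → τ) :
    Prop where
  K_indep : ∀ (m : Fin n → ℤ) (c : Fin n → ℂ), (∑ i, c i • K m i) = 0 →
      ∃ t : ℂ, ∀ i, c i = t * (m i : ℂ)
  W_indep : ∀ (m : Fin n → ℤ) (c : Fin n → ℂ), (∑ i, c i • W m i) = 0 → ∀ i, c i = 0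
  E_inj : ∀ (m : Fin n → ℤ) (x : 𝔤), E m x = 0 → x = 0
  EKW_indep : ∀ (m : Fin n → ℤ) (x : 𝔤) (c d : Fin n → ℂ),
      E m x + (∑ i, c i • K m i) + (∑ i, d i • W m i) = 0 →
      x = 0 ∧ (∀ i, d i = 0) ∧ ∃ t : ℂ, ∀ i, c i = t * (m i : ℂ)
  graded_indep : ∀ m : Fin n → ℤ,
      gradedPiece E K W m ⊓ (⨆ k : Fin n → ℤ, ⨆ _ : k ≠ m, gradedPiece E K W k) = ⊥

/-! ### Subsets of a lattice of rank at least two -/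

/-- A lattice of rank at least two has one end: there are no subsets `P`, `Q` each of which
contains one of `m`, `-m` for every `m ≠ 0`, such that every translate of `P` has finite
intersection with `-Q`. -/
lemma false_of_translates_inter_neg_finite {n : ℕ} (hn : 2 ≤ n) (P Q : Set (Fin n → ℤ))
    (hP : ∀ m, m ≠ 0 → m ∈ P ∨ -m ∈ P) (hQ : ∀ m, m ≠ 0 → m ∈ Q ∨ -m ∈ Q)
    (hPQ : ∀ d, {m | m + d ∈ P ∧ -m ∈ Q}.Finite) : False := by
  have hdisj : ∀ d, ∀ᶠ m in Filter.cofinite, m + d ∈ P → -m ∉ Q := fun d ↦ by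
    filter_upwards [(hPQ d).compl_mem_cofinite] with m hm h₁ h₂ using hm ⟨h₁, h₂⟩
  have hne : ∀ᶠ m : Fin n → ℤ in Filter.cofinite, m ≠ 0 := by
    filter_upwards [(Set.finite_singleton (0 : Fin n → ℤ)).compl_mem_cofinite] with m hm using hm
  have hneg : Filter.Tendsto (fun m : Fin n → ℤ ↦ -m) Filter.cofinite Filter.cofinite :=
    neg_injective.tendsto_cofinite
  have hdisj' : ∀ᶠ m in Filter.cofinite, -m ∈ P → m ∉ Q := by
    filter_upwards [hneg.eventually (hdisj 0)] with m hm h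
    simpa using hm (by simpa using h)
  have hsub : ∀ d, ∀ᶠ m in Filter.cofinite, m + d ∈ P → m ∈ P := fun d ↦ by
    filter_upwards [hdisj d, hdisj', hne] with m h₁ h₂ h₃ h
    have hmQ : m ∈ Q := (hQ m h₃).resolve_right (h₁ h)
    exact (hP m h₃).resolve_right fun h' ↦ h₂ h' hmQ
  have hinv : ∀ d, ∀ᶠ m in Filter.cofinite, (m + d ∈ P ↔ m ∈ P) := fun d ↦ by
    have hshift : Filter.Tendsto (fun m : Fin n → ℤ ↦ m + d) Filter.cofinite Filter.cofinite :=
      (add_left_injective d).tendsto_cofinite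
    filter_upwards [hsub d, hshift.eventually (hsub (-d))] with m h₁ h₂
    exact ⟨h₁, fun h ↦ h₂ (by simpa using h)⟩
  have hanti : ∀ᶠ m in Filter.cofinite, (m ∈ P ↔ -m ∉ P) := by
    filter_upwards [hdisj 0, hdisj', hne] with m h₁ h₂ h₃
    refine ⟨fun h h' ↦ ?_, (hP m h₃).resolve_right⟩
    exact (hQ m h₃).elim (h₂ h') (h₁ (by simpa using h))
  let i₀ : Fin n := ⟨0, by omega⟩
  let i₁ : Fin n := ⟨1, by omega⟩
  have hi : i₀ ≠ i₁ := by simp [i₀, i₁]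
  let e₀ : Fin n → ℤ := Pi.single i₀ 1
  let e₁ : Fin n → ℤ := Pi.single i₁ 1
  have hev := (hinv e₀).and ((hinv e₁).and hanti)
  rw [Filter.eventually_cofinite] at hev
  obtain ⟨k, hk⟩ : ∃ k : ℤ, ∀ m, |m i₀| ≥ k ∨ |m i₁| ≥ k →
      ((m + e₀ ∈ P ↔ m ∈ P) ∧ (m + e₁ ∈ P ↔ m ∈ P) ∧ (m ∈ P ↔ -m ∉ P)) := by
    obtain ⟨k, hk⟩ := (hev.image fun m ↦ max |m i₀| |m i₁|).bddAbove
    refine ⟨k + 1, fun m hm ↦ ?_⟩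
    by_contra hcon
    have := hk ⟨m, hcon, rfl⟩
    have h₀ := (le_max_left _ _).trans this
    have h₁ := (le_max_right _ _).trans this
    omega
  have hk_abs : k ≤ |k| := le_abs_self k
  let z : ℤ → ℤ → Fin n → ℤ := fun x y ↦ x • e₀ + y • e₁
  have z₀ : ∀ x y, z x y i₀ = x := fun x y ↦ by simp [z, e₀, e₁, hi]
  have z₁ : ∀ x y, z x y i₁ = y := fun x y ↦ by simp [z, e₀, e₁, hi.symm]
  have zadd₀ : ∀ x y, z x y + e₀ = z (x + 1) y := fun x y ↦ by simp only [z]; module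
  have zadd₁ : ∀ x y, z x y + e₁ = z x (y + 1) := fun x y ↦ by simp only [z]; module
  have hrow : ∀ x y : ℤ, |y| ≥ k → (z x y ∈ P ↔ z 0 y ∈ P) := fun x y hy ↦ by
    have hstep : ∀ x, z (x + 1) y ∈ P ↔ z x y ∈ P := fun x ↦ by
      rw [← zadd₀]; exact (hk _ (Or.inr (by rwa [z₁]))).1
    induction x using Int.induction_on with
    | zero => rfl
    | succ i ih => exact (hstep i).trans ih
    | pred i ih =>
      have := hstep (-i - 1)
      rw [sub_add_cancel] at this
      exact this.symm.trans ih
  have hcol : ∀ x y : ℤ, |x| ≥ k → (z x y ∈ P ↔ z x 0 ∈ P) := fun x y hx ↦ by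
    have hstep : ∀ y, z x (y + 1) ∈ P ↔ z x y ∈ P := fun y ↦ by
      rw [← zadd₁]; exact (hk _ (Or.inl (by rwa [z₀]))).2.1
    induction y using Int.induction_on with
    | zero => rfl
    | succ i ih => exact (hstep i).trans ih
    | pred i ih =>
      have := hstep (-i - 1)
      rw [sub_add_cancel] at this
      exact this.symm.trans ih
  have hk_neg : |(-k)| ≥ k := by rwa [abs_neg]
  have h₁ : z 0 k ∈ P ↔ z 0 (-k) ∈ P := by
    rw [← hrow k k hk_abs, hcol k k hk_abs, ← hcol k (-k) hk_abs, hrow k (-k) hk_neg]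
  have h₂ := (hk (z 0 k) (Or.inr (by rwa [z₁]))).2.2
  have h₃ : -z 0 k = z 0 (-k) := by simp only [z]; module
  rw [h₃] at h₂
  tauto

/-! ### Weight spaces -/

section weights

variable {L V : Type*} [LieRing L] [LieAlgebra ℂ L] [AddCommGroup V]
  [Module ℂ V] [LieRingModule L V] [LieModule ℂ L V]

lemma mem_weightSpace {d : Fin n → L} {l : Fin n → ℂ} {v : V} :
    v ∈ weightSpace d l ↔ ∀ i, ⁅d i, v⁆ = l i • v := Iff.rfl

lemma iSupIndep_weightSpace (d : Fin n → L) (hd : ∀ i j (v : V), ⁅d i, ⁅d j, v⁆⁆ = ⁅d j, ⁅d i, v⁆⁆) :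
    iSupIndep fun l : Fin n → ℂ ↦ weightSpace (V := V) d l := by
  let f : Fin n → Module.End ℂ V := fun i ↦ LieModule.toEnd ℂ L V (d i)
  have hf : ∀ i j, Commute (f i) (f j) := fun i j ↦ LinearMap.ext fun v ↦ hd i j v
  refine (Module.End.independent_iInf_maxGenEigenspace_of_forall_mapsTo f fun i j φ ↦
    Module.End.mapsTo_maxGenEigenspace_of_comm (hf j i) φ).mono fun l v hv ↦ ?_
  refine (Submodule.mem_iInf _).2 fun i ↦
    (Module.End.genEigenspace (f i) (l i)).monotone le_top (Module.End.mem_eigenspace_iff.2 (hv i))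

/-- A nonzero finite-dimensional space stable under commuting operators contains a common
eigenvector. -/
lemma exists_mem_weightSpace (d : Fin n → L)
    (hd : ∀ i j (v : V), ⁅d i, ⁅d j, v⁆⁆ = ⁅d j, ⁅d i, v⁆⁆)
    (U : Submodule ℂ V) [FiniteDimensional ℂ U] (hU : U ≠ ⊥)
    (hdU : ∀ i, ∀ v ∈ U, ⁅d i, v⁆ ∈ U) :
    ∃ l : Fin n → ℂ, ∃ v ∈ U, v ≠ 0 ∧ v ∈ weightSpace d l := by
  suffices h : ∀ s : Finset (Fin n), ∃ l : Fin n → ℂ, ∃ v ∈ U, v ≠ 0 ∧ ∀ i ∈ s, ⁅d i, v⁆ = l i • v by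
    obtain ⟨l, v, hv, hv0, h⟩ := h Finset.univ
    exact ⟨l, v, hv, hv0, fun i ↦ h i (Finset.mem_univ i)⟩
  intro s
  induction s using Finset.induction_on with
  | empty =>
    obtain ⟨v, hv, hv0⟩ := U.exists_mem_ne_zero_of_ne_bot hU
    exact ⟨0, v, hv, hv0, by simp⟩
  | insert j s hj ih =>
    obtain ⟨l, v, hv, hv0, h⟩ := ih
    let f : Fin n → Module.End ℂ V := fun i ↦ LieModule.toEnd ℂ L V (d i)
    let Y : Submodule ℂ V := U ⊓ ⨅ i ∈ s, (f i).eigenspace (l i)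
    have memY : ∀ x, x ∈ Y ↔ x ∈ U ∧ ∀ i ∈ s, ⁅d i, x⁆ = l i • x := fun x ↦ by
      simp [Y, f]
    have hY : ∀ x ∈ Y, f j x ∈ Y := fun x hx ↦ by
      rw [memY] at hx ⊢
      refine ⟨hdU j x hx.1, fun i hi ↦ ?_⟩
      change ⁅d i, ⁅d j, x⁆⁆ = l i • ⁅d j, x⁆
      rw [hd, hx.2 i hi, lie_smul]
    have : FiniteDimensional ℂ Y := Submodule.finiteDimensional_of_le inf_le_left
    have : Nontrivial Y := ⟨⟨v, (memY v).2 ⟨hv, h⟩⟩, 0, fun h' ↦ hv0 (congrArg Subtype.val h')⟩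
    obtain ⟨μ, hμ⟩ := Module.End.exists_eigenvalue ((f j).restrict hY)
    obtain ⟨x, hx⟩ := hμ.exists_hasEigenvector
    have hx' := (memY x).1 x.2
    refine ⟨Function.update l j μ, x, hx'.1, fun h0 ↦ hx.2 (Subtype.ext h0), fun i hi ↦ ?_⟩
    by_cases hij : i = j
    · subst hij
      simpa [f] using congrArg Subtype.val hx.apply_eq_smul
    · rw [Function.update_of_ne hij]
      exact hx'.2 i ((Finset.mem_insert.1 hi).resolve_left hij)

end weights

/-! ### The degree zero part of the full toroidal Lie algebra -/

section toroidal

variable {κ : 𝔤 →ₗ[ℂ] 𝔤 →ₗ[ℂ] ℂ} {c₁ c₂ : ℂ}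
  {E : (Fin n → ℤ) → 𝔤 →ₗ[ℂ] τ} {K W : (Fin n → ℤ) → Fin n → τ}

lemma IsFullToroidal.lie_W_zero (hτ : IsFullToroidal n 𝔤 τ κ c₁ c₂ E K W) {m : Fin n → ℤ} {X : τ}
    (hX : X ∈ genOfDeg E K W m) (i : Fin n) : ⁅W 0 i, X⁆ = (m i : ℂ) • X := by
  rcases hX with (⟨x, rfl⟩ | ⟨j, rfl⟩) | ⟨j, rfl⟩
  · simp [hτ.lie_W_E]
  · simp [hτ.lie_W_K]
  · simp [hτ.lie_W_W]

lemma IsFullToroidal.induction_gen (hτ : IsFullToroidal n 𝔤 τ κ c₁ c₂ E K W) (N : Submodule ℂ τ)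
    (hN : ∀ m, ∀ X ∈ genOfDeg E K W m, X ∈ N) (X : τ) : X ∈ N := by
  have : (⊤ : Submodule ℂ τ) ≤ N := by
    rw [← hτ.span_eq_top, Submodule.span_le]
    rintro _ ((⟨m, x, rfl⟩ | ⟨m, i, rfl⟩) | ⟨m, i, rfl⟩)
    · exact hN m _ (Or.inl (Or.inl ⟨x, rfl⟩))
    · exact hN m _ (Or.inl (Or.inr ⟨i, rfl⟩))
    · exact hN m _ (Or.inr ⟨i, rfl⟩)
  exact this trivial

lemma mem_of_forall_lie_mem [LieAlgebra.IsSimple ℂ 𝔤] {U : Submodule ℂ 𝔤}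
    (hU : ∀ x y : 𝔤, ⁅x, y⁆ ∈ U) (x : 𝔤) : x ∈ U := by
  have htop : ⁅(⊤ : LieIdeal ℂ 𝔤), (⊤ : LieIdeal ℂ 𝔤)⁆ = ⊤ := by
    refine (LieAlgebra.IsSimple.eq_bot_or_eq_top _).resolve_left fun h ↦
      LieAlgebra.IsSimple.non_abelian (R := ℂ) (L := 𝔤) ⟨fun x y ↦ ?_⟩
    have := LieSubmodule.lie_mem_lie (LieSubmodule.mem_top (R := ℂ) (L := 𝔤) x)
      (LieSubmodule.mem_top (R := ℂ) (L := 𝔤) y)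
    rw [h] at this
    exact this
  have hx : x ∈ LieSubmodule.toSubmodule ⁅(⊤ : LieIdeal ℂ 𝔤), (⊤ : LieIdeal ℂ 𝔤)⁆ := by
    rw [htop]; trivial
  rw [LieSubmodule.lieIdeal_oper_eq_linear_span'] at hx
  refine Submodule.span_le.2 ?_ hx
  rintro _ ⟨a, -, b, -, rfl⟩
  exact hU a b

/-- The degree zero part of `τ` is spanned by brackets of homogeneous elements of
degrees `m` and `-m`, for any fixed `m ≠ 0`. -/
lemma IsFullToroidal.mem_of_lie_mem [LieAlgebra.IsSimple ℂ 𝔤]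
    (hτ : IsFullToroidal n 𝔤 τ κ c₁ c₂ E K W) {m : Fin n → ℤ} (hm : m ≠ 0) (N : Submodule ℂ τ)
    (hN : ∀ X ∈ genOfDeg E K W m, ∀ Y ∈ genOfDeg E K W (-m), ⁅X, Y⁆ ∈ N) :
    ∀ Z ∈ genOfDeg E K W 0, Z ∈ N := by
  obtain ⟨i, hi⟩ := Function.ne_iff.1 hm
  have hi : (m i : ℂ) ≠ 0 := by exact_mod_cast hi
  have hE : ∀ k x, E k x ∈ genOfDeg E K W k := fun k x ↦ Or.inl (Or.inl ⟨x, rfl⟩)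
  have hK : ∀ k j, K k j ∈ genOfDeg E K W k := fun k j ↦ Or.inl (Or.inr ⟨j, rfl⟩)
  have hW : ∀ k j, W k j ∈ genOfDeg E K W k := fun k j ↦ Or.inr ⟨j, rfl⟩
  set z : τ := ∑ p, (m p : ℂ) • K 0 p with hz
  have hEE : ∀ x y, E 0 ⁅x, y⁆ + κ x y • z ∈ N := fun x y ↦ by
    have := hN _ (hE m x) _ (hE (-m) y)
    rwa [hτ.lie_E_E, add_neg_cancel] at this
  have hzN : z ∈ N := by
    obtain ⟨x, hx⟩ : ∃ x : 𝔤, x ≠ 0 := by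
      by_contra! h
      exact LieAlgebra.IsSimple.non_abelian (R := ℂ) (L := 𝔤) ⟨fun x y ↦ h _⟩
    obtain ⟨y, hy⟩ : ∃ y, κ x y ≠ 0 := by
      by_contra! h
      exact hx (hτ.κ_nondeg x h)
    have h := N.add_mem (hEE x y) (hEE y x)
    rw [← lie_skew x y, map_neg, hτ.κ_symm y x] at h
    have h' : (2 * κ x y) • z ∈ N := by
      convert h using 1
      module
    exact (N.smul_mem_iff (mul_ne_zero two_ne_zero hy)).1 h'
  have hKN : ∀ j, K 0 j ∈ N := fun j ↦ by
    have h := hN _ (hW m i) _ (hK (-m) j)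
    rw [hτ.lie_W_K, add_neg_cancel, ← hz] at h
    have h' : (if i = j then z else 0) ∈ N := by split_ifs; exacts [hzN, N.zero_mem]
    have := (N.add_mem_iff_left h').1 h
    refine (N.smul_mem_iff ?_).1 this
    simpa using hi
  have hWW : ∀ j, (m i : ℂ) • W 0 j + (m j : ℂ) • W 0 i ∈ N := fun j ↦ by
    have h := hN _ (hW m i) _ (hW (-m) j)
    rw [hτ.lie_W_W, add_neg_cancel, ← hz] at h
    have := N.neg_mem ((N.add_mem_iff_left (N.smul_mem _ hzN)).1 h)
    convert this using 1
    simp only [Pi.neg_apply, Int.cast_neg]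
    module
  have hWi : W 0 i ∈ N := by
    have h := hWW i
    rw [← add_smul] at h
    refine (N.smul_mem_iff ?_).1 h
    rw [← two_mul]
    exact mul_ne_zero two_ne_zero hi
  rintro _ ((⟨x, rfl⟩ | ⟨j, rfl⟩) | ⟨j, rfl⟩)
  · refine mem_of_forall_lie_mem (U := N.comap (E 0)) (fun x y ↦ ?_) x
    exact (N.add_mem_iff_left (N.smul_mem _ hzN)).1 (hEE x y)
  · exact hKN j
  · exact (N.smul_mem_iff hi).1 ((N.add_mem_iff_left (N.smul_mem _ hWi)).1 (hWW j))

lemma IsFullToroidal.lie_tmul_W_comm {B V : Type} [CommRing B] [Algebra ℂ B] [AddCommGroup V]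
    [LieRingModule (B ⊗[ℂ] τ) V]
    (hτ : IsFullToroidal n 𝔤 τ κ c₁ c₂ E K W)
    (a b : B) (i j : Fin n) (v : V) :
    ⁅a ⊗ₜ[ℂ] W 0 i, ⁅b ⊗ₜ[ℂ] W 0 j, v⁆⁆ = ⁅b ⊗ₜ[ℂ] W 0 j, ⁅a ⊗ₜ[ℂ] W 0 i, v⁆⁆ := by
  rw [leibniz_lie, LieAlgebra.ExtendScalars.bracket_tmul,
    hτ.lie_W_zero (m := 0) (Or.inr ⟨j, rfl⟩)]
  simp

end toroidal

/-! ### Modules annihilated by the product of two comaximal ideals -/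

section splitting

variable {B : Type} [CommRing B] [Algebra ℂ B] {V : Type} [AddCommGroup V] [Module ℂ V]
  [LieRingModule (B ⊗[ℂ] τ) V]

/-- `V` is annihilated by `τ ⊗ IJ`, and `u ∈ I`, `w ∈ J` witness that `I` and `J` are comaximal. -/
structure IsSplitting (τ V : Type) [LieRing τ] [LieAlgebra ℂ τ] [AddCommGroup V] [Module ℂ V]
    [LieRingModule (B ⊗[ℂ] τ) V] (I J : Ideal B) (u w : B) : Prop where
  left_mem : u ∈ I
  right_mem : w ∈ J
  add_eq_one : u + w = 1
  ann : annTensor τ B (I * J) V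

namespace IsSplitting

variable {I J : Ideal B} {u w : B}

lemma symm (h : IsSplitting τ V I J u w) : IsSplitting τ V J I w u :=
  ⟨h.right_mem, h.left_mem, by rw [add_comm, h.add_eq_one], by rw [mul_comm]; exact h.ann⟩

lemma lie_comm (h : IsSplitting τ V I J u w) {a b : B} (ha : a ∈ I) (hb : b ∈ J) (X Y : τ) (v : V) :
    ⁅a ⊗ₜ[ℂ] X, ⁅b ⊗ₜ[ℂ] Y, v⁆⁆ = ⁅b ⊗ₜ[ℂ] Y, ⁅a ⊗ₜ[ℂ] X, v⁆⁆ := by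
  rw [leibniz_lie, LieAlgebra.ExtendScalars.bracket_tmul, h.ann _ _ (Ideal.mul_mem_mul ha hb),
    zero_add]

lemma unit_lie (h : IsSplitting τ V I J u w) {a : B} (ha : a ∈ I) (X : τ) (v : V) :
    ⁅(u * a) ⊗ₜ[ℂ] X, v⁆ = ⁅a ⊗ₜ[ℂ] X, v⁆ := by
  have : a = u * a + a * w := by linear_combination a * (-h.add_eq_one)
  conv_rhs => rw [this, TensorProduct.add_tmul, add_lie,
    h.ann X _ (Ideal.mul_mem_mul ha h.right_mem), add_zero]

lemma lie_dOp {W : (Fin n → ℤ) → Fin n → τ} (h : IsSplitting τ V I J u w)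
    (i : Fin n) (v : V) :
    ⁅dOp B W i, v⁆ = ⁅u ⊗ₜ[ℂ] W 0 i, v⁆ + ⁅w ⊗ₜ[ℂ] W 0 i, v⁆ := by
  rw [← add_lie, ← TensorProduct.add_tmul, h.add_eq_one]
  rfl

/-- A nonzero subspace stable under `τ ⊗ I` and `τ ⊗ J` is everything. -/
lemma eq_top (hirr : LieModule.IsIrreducible ℂ (B ⊗[ℂ] τ) V) (h : IsSplitting τ V I J u w)
    (N : Submodule ℂ V) (hN : N ≠ ⊥) (hI : ∀ a ∈ I, ∀ X : τ, ∀ v ∈ N, ⁅a ⊗ₜ[ℂ] X, v⁆ ∈ N)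
    (hJ : ∀ a ∈ J, ∀ X : τ, ∀ v ∈ N, ⁅a ⊗ₜ[ℂ] X, v⁆ ∈ N) : N = ⊤ := by
  let N' : LieSubmodule ℂ (B ⊗[ℂ] τ) V :=
    { N with
      lie_mem := by
        intro x v hv
        induction x using TensorProduct.induction_on with
        | zero => rw [zero_lie]; exact N.zero_mem
        | add x y hx hy => rw [add_lie]; exact N.add_mem hx hy
        | tmul b X =>
          have : b = u * b + w * b := by rw [← add_mul, h.add_eq_one, one_mul]
          rw [this, TensorProduct.add_tmul, add_lie]
          exact N.add_mem (hI _ (I.mul_mem_right b h.left_mem) X v hv)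
            (hJ _ (J.mul_mem_right b h.right_mem) X v hv) }
  have hN' : (N' : Submodule ℂ V) = N := rfl
  rcases hirr.eq_bot_or_eq_top N' with h' | h'
  · exact (hN (by rw [← hN', h']; rfl)).elim
  · rw [← hN', h']; rfl

variable [LieModule ℂ (B ⊗[ℂ] τ) V] {κ : 𝔤 →ₗ[ℂ] 𝔤 →ₗ[ℂ] ℂ} {c₁ c₂ : ℂ}
  {E : (Fin n → ℤ) → 𝔤 →ₗ[ℂ] τ} {K W : (Fin n → ℤ) → Fin n → τ}

/-- The weight space of the operators `d_i ⊗ u`. -/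
noncomputable abbrev partWeight (V : Type) [AddCommGroup V] [Module ℂ V]
    [LieRingModule (B ⊗[ℂ] τ) V] [LieModule ℂ (B ⊗[ℂ] τ) V] (W : (Fin n → ℤ) → Fin n → τ) (u : B)
    (p : Fin n → ℂ) : Submodule ℂ V :=
  weightSpace (fun i ↦ u ⊗ₜ[ℂ] W 0 i) p

/-- The joint weight space of the operators `d_i ⊗ u` and `d_i ⊗ w`. -/
noncomputable abbrev jointWeight (V : Type) [AddCommGroup V] [Module ℂ V]
    [LieRingModule (B ⊗[ℂ] τ) V] [LieModule ℂ (B ⊗[ℂ] τ) V] (W : (Fin n → ℤ) → Fin n → τ) (u w : B)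
    (p q : Fin n → ℂ) : Submodule ℂ V :=
  partWeight V W u p ⊓ partWeight V W w q

/-- The elements of `τ` whose tensor product with `a` maps `U` to `U'`. -/
def transporter (a : B) (U U' : Submodule ℂ V) : Submodule ℂ τ where
  carrier := {X | ∀ v ∈ U, ⁅a ⊗ₜ[ℂ] X, v⁆ ∈ U'}
  add_mem' := by
    intro X Y hX hY v hv
    rw [TensorProduct.tmul_add, add_lie]
    exact U'.add_mem (hX v hv) (hY v hv)
  zero_mem' := by
    intro v _
    rw [TensorProduct.tmul_zero, zero_lie]
    exact U'.zero_mem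
  smul_mem' := by
    intro c X hX v hv
    rw [TensorProduct.tmul_smul, smul_lie]
    exact U'.smul_mem c (hX v hv)

lemma mem_transporter {a : B} {U U' : Submodule ℂ V} {X : τ} :
    X ∈ transporter a U U' ↔ ∀ v ∈ U, ⁅a ⊗ₜ[ℂ] X, v⁆ ∈ U' := Iff.rfl

lemma lie_mem_partWeight_add (hτ : IsFullToroidal n 𝔤 τ κ c₁ c₂ E K W)
    (h : IsSplitting τ V I J u w) {a : B} (ha : a ∈ I) {m : Fin n → ℤ} {X : τ}
    (hX : X ∈ genOfDeg E K W m) {p : Fin n → ℂ} {v : V} (hv : v ∈ partWeight V W u p) :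
    ⁅a ⊗ₜ[ℂ] X, v⁆ ∈ partWeight V W u (p + fun i ↦ (m i : ℂ)) := fun i ↦ by
  rw [leibniz_lie, LieAlgebra.ExtendScalars.bracket_tmul, hτ.lie_W_zero hX, h.unit_lie ha, hv i,
    TensorProduct.tmul_smul, smul_lie, lie_smul, Pi.add_apply, add_smul, add_comm]

lemma lie_mem_partWeight (h : IsSplitting τ V I J u w) {a : B} (ha : a ∈ J) (X : τ)
    {p : Fin n → ℂ} {v : V} (hv : v ∈ partWeight V W u p) :
    ⁅a ⊗ₜ[ℂ] X, v⁆ ∈ partWeight V W u p := fun i ↦ by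
  rw [h.lie_comm h.left_mem ha, hv i, lie_smul]

lemma lie_mem_jointWeight (hτ : IsFullToroidal n 𝔤 τ κ c₁ c₂ E K W)
    (h : IsSplitting τ V I J u w) {a : B} (ha : a ∈ I) {m : Fin n → ℤ} {X : τ}
    (hX : X ∈ genOfDeg E K W m) {p q : Fin n → ℂ} {v : V} (hv : v ∈ jointWeight V W u w p q) :
    ⁅a ⊗ₜ[ℂ] X, v⁆ ∈ jointWeight V W u w (p + fun i ↦ (m i : ℂ)) q :=
  ⟨h.lie_mem_partWeight_add hτ ha hX hv.1, h.symm.lie_mem_partWeight ha X hv.2⟩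

lemma jointWeight_swap (p q : Fin n → ℂ) :
    jointWeight V W u w p q = jointWeight V W w u q p := inf_comm _ _

lemma iSupIndep_partWeight (hτ : IsFullToroidal n 𝔤 τ κ c₁ c₂ E K W) (u : B) :
    iSupIndep fun p : Fin n → ℂ ↦ partWeight V W u p :=
  iSupIndep_weightSpace _ (hτ.lie_tmul_W_comm u u)

lemma jointWeight_le_weightSpace (h : IsSplitting τ V I J u w) (p q : Fin n → ℂ) :
    jointWeight V W u w p q ≤ weightSpace (dOp B W) (p + q) := fun v hv i ↦ by
  rw [h.lie_dOp, hv.1 i, hv.2 i, ← add_smul, Pi.add_apply]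

lemma iSup_jointWeight_stable (hτ : IsFullToroidal n 𝔤 τ κ c₁ c₂ E K W)
    (h : IsSplitting τ V I J u w) {a : B} (ha : a ∈ J) (X : τ) (p : Fin n → ℂ) :
    ∀ v ∈ ⨆ q, jointWeight V W u w p q, ⁅a ⊗ₜ[ℂ] X, v⁆ ∈ ⨆ q, jointWeight V W u w p q := by
  rw [← mem_transporter]
  refine hτ.induction_gen _ (fun m X hX ↦ mem_transporter.2 fun v hv ↦ ?_) X
  suffices (⨆ q, jointWeight V W u w p q) ≤
      (⨆ q, jointWeight V W u w p q).comap (LieModule.toEnd ℂ (B ⊗[ℂ] τ) V (a ⊗ₜ[ℂ] X)) from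
    this hv
  refine iSup_le fun q v hv ↦ ?_
  refine Submodule.mem_iSup_of_mem (q + fun i ↦ (m i : ℂ)) ?_
  rw [jointWeight_swap] at hv ⊢
  exact h.symm.lie_mem_jointWeight hτ ha hX hv

lemma iSup_iSup_jointWeight_eq_top (hτ : IsFullToroidal n 𝔤 τ κ c₁ c₂ E K W)
    (hirr : LieModule.IsIrreducible ℂ (B ⊗[ℂ] τ) V) (hHC : IsHarishChandra (V := V) (dOp B W))
    (h : IsSplitting τ V I J u w) : ⨆ p, ⨆ q, jointWeight V W u w p q = ⊤ := by
  have stable : ∀ {I J : Ideal B} {u w : B}, IsSplitting τ V I J u w → ∀ a ∈ J, ∀ X : τ,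
      ∀ v ∈ ⨆ p, ⨆ q, jointWeight V W u w p q,
        ⁅a ⊗ₜ[ℂ] X, v⁆ ∈ ⨆ p, ⨆ q, jointWeight V W u w p q := by
    intro I J u w h a ha X v hv
    suffices (⨆ p, ⨆ q, jointWeight V W u w p q) ≤ (⨆ p, ⨆ q, jointWeight V W u w p q).comap
        (LieModule.toEnd ℂ (B ⊗[ℂ] τ) V (a ⊗ₜ[ℂ] X)) from this hv
    exact iSup_le fun p v hv ↦
      Submodule.mem_iSup_of_mem p (h.iSup_jointWeight_stable hτ ha X p v hv)
  refine h.eq_top hirr _ ?_ ?_ (stable h)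
  · obtain ⟨l, hl⟩ : ∃ l, weightSpace (V := V) (dOp B W) l ≠ ⊥ := by
      by_contra! h0
      have := hHC.1
      simp only [h0, iSup_bot] at this
      refine bot_ne_top (α := LieSubmodule ℂ (B ⊗[ℂ] τ) V) ?_
      rw [← LieSubmodule.toSubmodule_inj]
      exact this
    have := hHC.2 l
    obtain ⟨p, v, hvl, hv0, hv⟩ := exists_mem_weightSpace (fun i ↦ u ⊗ₜ[ℂ] W 0 i)
      (hτ.lie_tmul_W_comm u u) (weightSpace (V := V) (dOp B W) l) hl
      (fun i v hv j ↦ by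
        rw [dOp, hτ.lie_tmul_W_comm]
        change ⁅_, ⁅dOp B W j, v⁆⁆ = _
        rw [hv j, lie_smul])
    refine (Submodule.ne_bot_iff _).2 ⟨v, ?_, hv0⟩
    refine Submodule.mem_iSup_of_mem p (Submodule.mem_iSup_of_mem (l - p) ⟨hv, fun i ↦ ?_⟩)
    have := hvl i
    rw [h.lie_dOp, hv i] at this
    rw [Pi.sub_apply, sub_smul, ← this, add_sub_cancel_left]
  · have := stable h.symm
    rw [iSup_comm] at this
    simpa only [jointWeight_swap (u := w) (w := u)] using this

/-- The set of pairs of weights occurring in `V` is a product. -/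
lemma jointWeight_ne_bot (hτ : IsFullToroidal n 𝔤 τ κ c₁ c₂ E K W)
    (hirr : LieModule.IsIrreducible ℂ (B ⊗[ℂ] τ) V) (h : IsSplitting τ V I J u w)
    {p p' q q' : Fin n → ℂ} (hp : jointWeight V W u w p q ≠ ⊥)
    (hq : jointWeight V W u w p' q' ≠ ⊥) : jointWeight V W u w p q' ≠ ⊥ := by
  intro hbot
  set A : Submodule ℂ V := ⨆ q, jointWeight V W u w p q with hA
  set Q : Submodule ℂ V := ⨆ r, ⨆ _ : r ≠ q', partWeight V W w r with hQ
  have hAQ : A ≤ Q := iSup_le fun r ↦ by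
    by_cases hr : r = q'
    · rw [hr, hbot]; exact bot_le
    · exact inf_le_right.trans (le_iSup₂_of_le r hr le_rfl)
  have hQI : ∀ a ∈ I, ∀ X : τ, ∀ v ∈ Q, ⁅a ⊗ₜ[ℂ] X, v⁆ ∈ Q := fun a ha X v hv ↦ by
    suffices Q ≤ Q.comap (LieModule.toEnd ℂ (B ⊗[ℂ] τ) V (a ⊗ₜ[ℂ] X)) from this hv
    exact iSup₂_le fun r hr v hv ↦ (le_iSup₂_of_le (f := fun r _ ↦ partWeight V W w r) r hr le_rfl)
      (h.symm.lie_mem_partWeight ha X hv)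
  let S : Set (Submodule ℂ V) := {U | A ≤ U ∧ ∀ a ∈ I, ∀ X : τ, ∀ v ∈ U, ⁅a ⊗ₜ[ℂ] X, v⁆ ∈ U}
  have hAS : A ≤ sInf S := le_sInf fun U hU ↦ hU.1
  have hIS : ∀ a ∈ I, ∀ X : τ, ∀ v ∈ sInf S, ⁅a ⊗ₜ[ℂ] X, v⁆ ∈ sInf S := fun a ha X v hv ↦ by
    rw [Submodule.mem_sInf] at hv ⊢
    exact fun U hU ↦ hU.2 a ha X v (hv U hU)
  have hJS : ∀ b ∈ J, ∀ Y : τ, ∀ v ∈ sInf S, ⁅b ⊗ₜ[ℂ] Y, v⁆ ∈ sInf S := fun b hb Y v hv ↦ by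
    let U := sInf S ⊓ (sInf S).comap (LieModule.toEnd ℂ (B ⊗[ℂ] τ) V (b ⊗ₜ[ℂ] Y))
    have hU : U ∈ S := by
      refine ⟨fun x hx ↦ ⟨hAS hx, hAS (h.iSup_jointWeight_stable hτ hb Y p x hx)⟩,
        fun a ha X x hx ↦ ⟨hIS a ha X x hx.1, ?_⟩⟩
      change ⁅b ⊗ₜ[ℂ] Y, ⁅a ⊗ₜ[ℂ] X, x⁆⁆ ∈ sInf S
      rw [← h.lie_comm ha hb]
      exact hIS a ha X _ hx.2
    exact (sInf_le hU hv).2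
  have hA0 : A ≠ ⊥ := fun h0 ↦ hp (eq_bot_iff.2 ((le_iSup _ q).trans h0.le))
  have htop : sInf S = ⊤ :=
    h.eq_top hirr _ (fun h0 ↦ hA0 (eq_bot_iff.2 (hAS.trans h0.le))) hIS hJS
  have hQtop : Q = ⊤ := top_le_iff.1 (htop ▸ sInf_le ⟨hAQ, hQI⟩)
  have hdisj := iSupIndep_partWeight (V := V) hτ w q'
  rw [← hQ, hQtop, disjoint_top] at hdisj
  exact hq (eq_bot_iff.2 (inf_le_right.trans hdisj.le))

/-- The set of weights of the operators `d_i ⊗ u`, when `V` is also decomposed with respect to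
the operators `d_i ⊗ w`. -/
def partSupport (V : Type) [AddCommGroup V] [Module ℂ V] [LieRingModule (B ⊗[ℂ] τ) V]
    [LieModule ℂ (B ⊗[ℂ] τ) V] (W : (Fin n → ℤ) → Fin n → τ) (u w : B) : Set (Fin n → ℂ) :=
  {p | ∃ q, jointWeight V W u w p q ≠ ⊥}

lemma lie_eq_zero_of_notMem_partSupport (hτ : IsFullToroidal n 𝔤 τ κ c₁ c₂ E K W)
    (h : IsSplitting τ V I J u w) {m : Fin n → ℤ} {p q : Fin n → ℂ}
    (hp : (p + fun i ↦ (m i : ℂ)) ∉ partSupport V W u w) {a : B} (ha : a ∈ I) {X : τ}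
    (hX : X ∈ genOfDeg E K W m) {v : V} (hv : v ∈ jointWeight V W u w p q) :
    ⁅a ⊗ₜ[ℂ] X, v⁆ = 0 := by
  have hbot : jointWeight V W u w (p + fun i ↦ (m i : ℂ)) q = ⊥ := by
    by_contra h0
    exact hp ⟨q, h0⟩
  have := h.lie_mem_jointWeight hτ ha hX hv
  rwa [hbot, Submodule.mem_bot] at this

lemma degree_zero_lie_eq_zero [LieAlgebra.IsSimple ℂ 𝔤]
    (hτ : IsFullToroidal n 𝔤 τ κ c₁ c₂ E K W) (h : IsSplitting τ V I J u w)
    {m : Fin n → ℤ} (hm : m ≠ 0) {p q : Fin n → ℂ}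
    (hp : (p + fun i ↦ (m i : ℂ)) ∉ partSupport V W u w)
    (hp' : (p + fun i ↦ ((-m) i : ℂ)) ∉ partSupport V W u w) {a : B} (ha : a ∈ I) {X : τ}
    (hX : X ∈ genOfDeg E K W 0) {v : V} (hv : v ∈ jointWeight V W u w p q) :
    ⁅a ⊗ₜ[ℂ] X, v⁆ = 0 := by
  refine hτ.mem_of_lie_mem hm (transporter a (jointWeight V W u w p q) ⊥) ?_ X hX v hv
  intro X hX Y hY v hv
  rw [Submodule.mem_bot, ← h.unit_lie ha, ← LieAlgebra.ExtendScalars.bracket_tmul, lie_lie,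
    h.lie_eq_zero_of_notMem_partSupport hτ hp' ha hY hv,
    h.lie_eq_zero_of_notMem_partSupport hτ hp h.left_mem hX hv, lie_zero, lie_zero, sub_zero]

lemma mem_partSupport_or [LieAlgebra.IsSimple ℂ 𝔤]
    (hτ : IsFullToroidal n 𝔤 τ κ c₁ c₂ E K W) (h : IsSplitting τ V I J u w) {p : Fin n → ℂ}
    (hp : p ∈ partSupport V W u w) (hp0 : p ≠ 0) {m : Fin n → ℤ} (hm : m ≠ 0) :
    (p + fun i ↦ (m i : ℂ)) ∈ partSupport V W u w ∨
      (p + fun i ↦ ((-m) i : ℂ)) ∈ partSupport V W u w := by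
  by_contra! hcon
  obtain ⟨q, hq⟩ := hp
  obtain ⟨v, hv, hv0⟩ := Submodule.exists_mem_ne_zero_of_ne_bot hq
  refine hp0 (funext fun i ↦ ?_)
  have := h.degree_zero_lie_eq_zero hτ hm hcon.1 hcon.2 h.left_mem
    (Or.inr ⟨i, rfl⟩ : W 0 i ∈ genOfDeg E K W 0) hv
  rw [hv.1 i] at this
  exact (smul_eq_zero.1 this).resolve_right hv0

lemma annTensor_of_partSupport_subset [LieAlgebra.IsSimple ℂ 𝔤] (hn : 0 < n)
    (hτ : IsFullToroidal n 𝔤 τ κ c₁ c₂ E K W)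
    (hirr : LieModule.IsIrreducible ℂ (B ⊗[ℂ] τ) V) (hHC : IsHarishChandra (V := V) (dOp B W))
    (h : IsSplitting τ V I J u w) (hS : partSupport V W u w ⊆ {0}) : annTensor τ B I V := by
  intro X a ha v
  have hdeg : ∀ m : Fin n → ℤ, m ≠ 0 →
      (0 + fun i ↦ (m i : ℂ) : Fin n → ℂ) ∉ partSupport V W u w := fun m hm h0 ↦ hm <| by
    have := hS h0
    rw [Set.mem_singleton_iff, zero_add] at this
    exact funext fun i ↦ Int.cast_eq_zero.1 (congrFun this i)
  suffices X ∈ transporter a (⨆ p, ⨆ q, jointWeight V W u w p q) ⊥ by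
    rw [h.iSup_iSup_jointWeight_eq_top hτ hirr hHC] at this
    exact this v trivial
  refine hτ.induction_gen _ (fun m X hX ↦ mem_transporter.2 fun v hv ↦ ?_) X
  suffices (⨆ p, ⨆ q, jointWeight V W u w p q) ≤
      LinearMap.ker (LieModule.toEnd ℂ (B ⊗[ℂ] τ) V (a ⊗ₜ[ℂ] X)) from this hv
  refine iSup_le fun p ↦ iSup_le fun q v hv ↦ ?_
  change ⁅a ⊗ₜ[ℂ] X, v⁆ = 0
  by_cases hbot : jointWeight V W u w p q = ⊥
  · rw [hbot, Submodule.mem_bot] at hv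
    rw [hv, lie_zero]
  obtain rfl : p = 0 := hS ⟨q, hbot⟩
  by_cases hm : m = 0
  · subst hm
    have hone : (Pi.single ⟨0, hn⟩ 1 : Fin n → ℤ) ≠ 0 := by simp
    exact h.degree_zero_lie_eq_zero hτ hone (hdeg _ hone) (hdeg _ (neg_ne_zero.2 hone)) ha hX hv
  · exact h.lie_eq_zero_of_notMem_partSupport hτ (hdeg m hm) ha hX hv

lemma partSupport_finite (hτ : IsFullToroidal n 𝔤 τ κ c₁ c₂ E K W)
    (hirr : LieModule.IsIrreducible ℂ (B ⊗[ℂ] τ) V) (hHC : IsHarishChandra (V := V) (dOp B W))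
    (h : IsSplitting τ V I J u w) (l : Fin n → ℂ) :
    {p | p ∈ partSupport V W u w ∧ l - p ∈ partSupport V W w u}.Finite := by
  have hne : ∀ p : {p | p ∈ partSupport V W u w ∧ l - p ∈ partSupport V W w u},
      ∃ v ∈ jointWeight V W u w p (l - p), v ≠ 0 := by
    rintro ⟨p, ⟨q, hq⟩, q', hq'⟩
    rw [jointWeight_swap] at hq'
    exact Submodule.exists_mem_ne_zero_of_ne_bot (h.jointWeight_ne_bot hτ hirr hq hq')
  choose f hf hf0 using hne
  have hind : LinearIndependent ℂ f :=
    ((iSupIndep_partWeight (V := V) hτ u).comp Subtype.val_injective).linearIndependent _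
      (fun p ↦ (hf p).1) hf0
  have hfl : ∀ p, f p ∈ weightSpace (V := V) (dOp B W) l := fun p ↦ by
    simpa using h.jointWeight_le_weightSpace _ _ (hf p)
  have := hHC.2 l
  have hind' : LinearIndependent ℂ fun p ↦ (⟨f p, hfl p⟩ : weightSpace (V := V) (dOp B W) l) :=
    LinearIndependent.of_comp (weightSpace (V := V) (dOp B W) l).subtype hind
  exact Set.finite_coe_iff.1 hind'.finite

end IsSplitting

end splitting

theorem statement_10
    (n : ℕ) (hn : 3 ≤ n)
    (𝔤 : Type) [LieRing 𝔤] [LieAlgebra ℂ 𝔤] [LieAlgebra.IsSimple ℂ 𝔤]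
    [FiniteDimensional ℂ 𝔤]
    (τ : Type) [LieRing τ] [LieAlgebra ℂ τ]
    (κ : 𝔤 →ₗ[ℂ] 𝔤 →ₗ[ℂ] ℂ) (c₁ c₂ : ℂ)
    (E : (Fin n → ℤ) → 𝔤 →ₗ[ℂ] τ) (K W : (Fin n → ℤ) → Fin n → τ)
    (hτ : IsFullToroidal n 𝔤 τ κ c₁ c₂ E K W)
    (B : Type) [CommRing B] [Algebra ℂ B] [Nontrivial B]
    (hB : Algebra.FiniteType ℂ B)
    (V : Type) [AddCommGroup V] [Module ℂ V]
    [LieRingModule (B ⊗[ℂ] τ) V] [LieModule ℂ (B ⊗[ℂ] τ) V]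
    (hirr : LieModule.IsIrreducible ℂ (B ⊗[ℂ] τ) V)
    (hcusp : IsCuspidal (V := V) (dOp B W))
    (𝔐₁ 𝔐₂ : Ideal B) (hcop : 𝔐₁ ⊔ 𝔐₂ = ⊤)
    (hann : annTensor τ B (𝔐₁ * 𝔐₂) V) :
    annTensor τ B 𝔐₁ V ∨ annTensor τ B 𝔐₂ V := by
  obtain ⟨u, hu, w, hw, huw⟩ := Submodule.mem_sup.1 (hcop ▸ Submodule.mem_top : (1 : B) ∈ 𝔐₁ ⊔ 𝔐₂)
  have h : IsSplitting τ V 𝔐₁ 𝔐₂ u w := ⟨hu, hw, huw, hann⟩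
  by_cases hS₁ : IsSplitting.partSupport V W u w ⊆ {0}
  · exact Or.inl (h.annTensor_of_partSupport_subset (by omega) hτ hirr hcusp.1 hS₁)
  by_cases hS₂ : IsSplitting.partSupport V W w u ⊆ {0}
  · exact Or.inr (h.symm.annTensor_of_partSupport_subset (by omega) hτ hirr hcusp.1 hS₂)
  obtain ⟨p, hp, hp0⟩ := Set.not_subset.1 hS₁
  obtain ⟨q, hq, hq0⟩ := Set.not_subset.1 hS₂
  refine (false_of_translates_inter_neg_finite (by omega)
    {m | (p + fun i ↦ (m i : ℂ)) ∈ IsSplitting.partSupport V W u w}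
    {m | (q + fun i ↦ (m i : ℂ)) ∈ IsSplitting.partSupport V W w u}
    (fun m hm ↦ h.mem_partSupport_or hτ hp hp0 hm)
    (fun m hm ↦ h.symm.mem_partSupport_or hτ hq hq0 hm) fun d ↦ ?_).elim
  have hinj : Function.Injective fun m : Fin n → ℤ ↦ p + fun i ↦ ((m + d) i : ℂ) := by
    intro m m' hmm'
    funext i
    simpa using congrFun hmm' i
  refine ((h.partSupport_finite hτ hirr hcusp.1 (p + q + fun i ↦ (d i : ℂ))).preimage
    hinj.injOn).subset fun m hm ↦ ⟨hm.1, ?_⟩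
  have hm₂ : (q + fun i ↦ ((-m) i : ℂ)) ∈ IsSplitting.partSupport V W w u := hm.2
  convert hm₂ using 1
  funext i
  simp only [Pi.add_apply, Pi.sub_apply, Pi.neg_apply, Int.cast_add, Int.cast_neg]
  ring

end MT
end

section
/- Let V be an irreducible cuspidal Harish-Chandra module over τ(B), and let 𝔐 be a cofinite ideal of B (dim_ℂ B/𝔐 < ∞) such that (τ ⊗ 𝔐^k)·V = 0 for some k ∈ ℕ. Then (τ ⊗ 𝔐)·V = 0. -/
open scoped TensorProduct

namespace MT

variable {n : ℕ} {𝔤 : Type} [LieRing 𝔤] [LieAlgebra ℂ 𝔤]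
variable {τ : Type} [LieRing τ] [LieAlgebra ℂ τ]

/-! ### Commutator identities in associative rings -/

theorem mul_pow_of_mul_eq {R : Type*} [Ring R] {x y z : R} (hyz : Commute y z)
    (h : x * y = y * x + z) (p : ℕ) :
    x * y ^ (p + 1) = y ^ (p + 1) * x + ((p : R) + 1) * (y ^ p * z) := by
  induction p with
  | zero => simp [h]
  | succ p ih =>
    have hc : y ^ p * z * y = y ^ (p + 1) * z := by
      rw [mul_assoc, ← hyz.eq, ← mul_assoc, pow_succ]
    calc x * y ^ (p + 1 + 1) = x * y ^ (p + 1) * y := by rw [pow_succ _ (p + 1), mul_assoc]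
      _ = y ^ (p + 1) * (x * y) + ((p : R) + 1) * (y ^ p * z * y) := by rw [ih]; noncomm_ring
      _ = y ^ (p + 1 + 1) * x + ((((p + 1 : ℕ) : R)) + 1) * (y ^ (p + 1) * z) := by
        rw [h, hc, pow_succ _ (p + 1)]; push_cast; noncomm_ring

/-- If `[x, y] = z`, `[x, z] = w` and `y, z, w` commute, then `z` is nilpotent
whenever `y` is. -/
theorem isNilpotent_of_mul_eq {R : Type*} [Ring R] [Algebra ℂ R] {x y z w : R}
    (hyz : Commute y z) (hzw : Commute z w)
    (hxy : x * y = y * x + z) (hxz : x * z = z * x + w) (hy : IsNilpotent y) :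
    IsNilpotent z := by
  obtain ⟨p, hp⟩ := hy
  suffices H : ∀ p q : ℕ, y ^ p * z ^ (q + 1) = 0 → IsNilpotent z by
    exact H p 0 (by rw [hp, zero_mul])
  intro p
  induction p with
  | zero => exact fun q hq => ⟨q + 1, by simpa using hq⟩
  | succ p ih =>
    intro q hq
    refine ih (q + 2) ?_
    have h1 := mul_pow_of_mul_eq hyz hxy p
    have h2 := mul_pow_of_mul_eq hzw hxz q
    have hz : y ^ (p + 1) * (z ^ q * w) * z = 0 := by
      have : y ^ (p + 1) * (z ^ q * w) * z = y ^ (p + 1) * z ^ (q + 1) * w := by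
        rw [pow_succ z, mul_assoc, mul_assoc, mul_assoc, mul_assoc, hzw.eq]
      rw [this, hq, zero_mul]
    have hcomb : ((p : R) + 1) * (y ^ p * z * z ^ (q + 1) * z) = 0 := by
      calc ((p : R) + 1) * (y ^ p * z * z ^ (q + 1) * z)
          = (((p : R) + 1) * (y ^ p * z)) * z ^ (q + 1) * z := by noncomm_ring
        _ = (x * y ^ (p + 1) - y ^ (p + 1) * x) * z ^ (q + 1) * z := by rw [h1]; noncomm_ring
        _ = x * (y ^ (p + 1) * z ^ (q + 1)) * z - y ^ (p + 1) * (x * z ^ (q + 1)) * z := by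
          noncomm_ring
        _ = x * (y ^ (p + 1) * z ^ (q + 1)) * z - (y ^ (p + 1) * z ^ (q + 1)) * (x * z)
            - (q + 1 : R) * (y ^ (p + 1) * (z ^ q * w) * z) := by
          rw [h2]
          have hcq : Commute (y ^ (p + 1)) ((q : R) + 1) :=
            ((Nat.cast_commute q _).symm).add_right (Commute.one_right _)
          have e : y ^ (p + 1) * (((q : R) + 1) * (z ^ q * w)) * z
              = ((q : R) + 1) * (y ^ (p + 1) * (z ^ q * w) * z) := by
            rw [← mul_assoc (y ^ (p + 1)), hcq.eq]; noncomm_ring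
          rw [mul_add, add_mul, e]; noncomm_ring
        _ = 0 := by rw [hq, hz]; simp
    have hinv : ((p : R) + 1) = algebraMap ℂ R ((p : ℂ) + 1) := by simp
    rw [hinv, ← Algebra.smul_def] at hcomb
    have := (smul_eq_zero_iff_right (Nat.cast_add_one_ne_zero p : (p : ℂ) + 1 ≠ 0)).1 hcomb
    rw [← this, pow_add z, pow_succ z]
    have : z * z ^ q = z ^ q * z := (Commute.self_pow z q).eq
    simp only [mul_assoc, pow_succ, pow_zero, one_mul]
    rw [← mul_assoc z (z ^ q), this]
    simp only [mul_assoc]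

/-- The commutator with `x` is a derivation, so it preserves the powers of every
subspace which it preserves. -/
theorem commutator_mem_pow {R : Type*} [Ring R] [Algebra ℂ R] {T : Submodule ℂ R} {x : R}
    (hT : ∀ z ∈ T, x * z - z * x ∈ T) (j : ℕ) {q : R} (hq : q ∈ T ^ j) :
    x * q - q * x ∈ T ^ j := by
  induction j generalizing q with
  | zero =>
    rw [pow_zero, Submodule.mem_one] at hq
    obtain ⟨c, rfl⟩ := hq
    rw [(Algebra.commutes c x).symm, sub_self]
    exact zero_mem _
  | succ j ih =>
    rw [pow_succ'] at hq ⊢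
    refine Submodule.mul_induction_on hq (fun z hz r hr => ?_) (fun r s hr hs => ?_)
    · have : x * (z * r) - z * r * x = (x * z - z * x) * r + z * (x * r - r * x) := by
        noncomm_ring
      rw [this]
      exact add_mem (Submodule.mul_mem_mul (hT z hz) hr) (Submodule.mul_mem_mul hz (ih hr))
    · have : x * (r + s) - (r + s) * x = (x * r - r * x) + (x * s - s * x) := by noncomm_ring
      rw [this]
      exact add_mem hr hs

theorem commute_of_mem_pow {R : Type*} [Ring R] [Algebra ℂ R] {T : Submodule ℂ R} {y : R}
    (hT : ∀ z ∈ T, Commute y z) (j : ℕ) {q : R} (hq : q ∈ T ^ j) : Commute y q := by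
  induction j generalizing q with
  | zero =>
    rw [pow_zero, Submodule.mem_one] at hq
    obtain ⟨c, rfl⟩ := hq
    exact (Algebra.commutes c y).symm
  | succ j ih =>
    rw [pow_succ] at hq
    exact Submodule.mul_induction_on hq (fun r hr z hz => (ih hr).mul_right (hT z hz))
      fun r s hr hs => hr.add_right hs

theorem mul_mem_pow_succ {R : Type*} [Ring R] [Algebra ℂ R] {T : Submodule ℂ R} {z q : R}
    (hz : z ∈ T) {j : ℕ} (hq : q ∈ T ^ j) : z * q ∈ T ^ (j + 1) := by
  rw [pow_succ']
  exact Submodule.mul_mem_mul hz hq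

theorem one_mem_pow_zero {R : Type*} [Ring R] [Algebra ℂ R] (T : Submodule ℂ R) :
    (1 : R) ∈ T ^ 0 := by
  rw [pow_zero]
  exact Submodule.one_le.1 le_rfl

/-- Let `ν` be nilpotent and `T` a space of operators which is spanned by commutators
`[x, ν]`, commutes with `ν`, and is preserved by the commutators with these `x`.
Then `T` is nilpotent. -/
theorem pow_eq_bot_of_commutator {R : Type*} [Ring R] [Algebra ℂ R] {ν : R} {S : Set R}
    {N : ℕ} (hν : ν ^ N = 0)
    (hS : ∀ z ∈ S, Commute ν z ∧ ∃ x : R, ∃ c : ℂ, c ≠ 0 ∧ x * ν = ν * x + c • z ∧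
      ∀ y ∈ Submodule.span ℂ S, x * y - y * x ∈ Submodule.span ℂ S) :
    Submodule.span ℂ S ^ N = ⊥ := by
  suffices H : ∀ j p : ℕ, p + j = N → ∀ q ∈ Submodule.span ℂ S ^ j, ν ^ p * q = 0 by
    refine (Submodule.eq_bot_iff _).2 fun q hq => ?_
    simpa using H N 0 (zero_add N) q hq
  intro j
  induction j with
  | zero =>
    intro p hp q _
    obtain rfl : p = N := by simpa using hp
    rw [hν, zero_mul]
  | succ j ih =>
    intro p hp q hq
    have ih' := ih (p + 1) (by omega)
    rw [pow_succ'] at hq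
    refine Submodule.mul_induction_on hq (fun z hz r hr => ?_)
      (fun r s hr hs => by rw [mul_add, hr, hs, add_zero])
    induction hz using Submodule.span_induction with
    | zero => simp
    | add y z _ _ hy hz => rw [add_mul, mul_add, hy, hz, add_zero]
    | smul c z _ hz => rw [smul_mul_assoc, mul_smul_comm, hz, smul_zero]
    | mem z hz =>
      obtain ⟨hc, x, c, hc0, hx, hstab⟩ := hS z hz
      have h1 := mul_pow_of_mul_eq (hc.smul_right c) hx p
      have h2 := ih' _ (commutator_mem_pow hstab j hr)
      have h3 : ((p : R) + 1) * (ν ^ p * c • z) * r = 0 := by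
        calc ((p : R) + 1) * (ν ^ p * c • z) * r
            = (x * ν ^ (p + 1) - ν ^ (p + 1) * x) * r := by rw [h1]; noncomm_ring
          _ = x * (ν ^ (p + 1) * r) - ν ^ (p + 1) * r * x
              - ν ^ (p + 1) * (x * r - r * x) := by noncomm_ring
          _ = 0 := by rw [h2, ih' r hr]; simp
      have hinv : ((p : R) + 1) = algebraMap ℂ R ((p : ℂ) + 1) := by simp
      rw [hinv, mul_smul_comm, ← Algebra.smul_def, smul_smul, smul_mul_assoc, mul_assoc] at h3
      exact (smul_eq_zero_iff_right
        (mul_ne_zero (Nat.cast_add_one_ne_zero p : (p : ℂ) + 1 ≠ 0) hc0)).1 h3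

/-! ### Common kernels of commuting operators -/

/-- A family of commuting nilpotent operators on a nonzero finite-dimensional space has a
common kernel. -/
theorem exists_common_kernel {V : Type*} [AddCommGroup V] [Module ℂ V]
    (S : Set (Module.End ℂ V)) (hcomm : ∀ y ∈ S, ∀ z ∈ S, Commute y z)
    (hnil : ∀ z ∈ S, IsNilpotent z) (U : Submodule ℂ V) [FiniteDimensional ℂ U]
    (hU : U ≠ ⊥) (hSU : ∀ z ∈ S, ∀ v ∈ U, z v ∈ U) :
    ∃ v ≠ 0, ∀ z ∈ S, z v = 0 := by
  induction h : Module.finrank ℂ U using Nat.strong_induction_on generalizing U with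
  | _ d ih =>
    subst h
    by_cases hz : ∀ z ∈ S, ∀ v ∈ U, z v = 0
    · obtain ⟨v, hv, hv0⟩ := Submodule.exists_mem_ne_zero_of_ne_bot hU
      exact ⟨v, hv0, fun z hzS => hz z hzS v hv⟩
    · push Not at hz
      obtain ⟨z, hzS, v, hv, hzv⟩ := hz
      have hle : U.map z ≤ U := Submodule.map_le_iff_le_comap.2 fun u hu => hSU z hzS u hu
      have hne : U.map z ≠ U := by
        intro heq
        obtain ⟨p, hp⟩ := hnil z hzS
        have hpow : ∀ p : ℕ, U.map (z ^ p) = U := by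
          intro p
          induction p with
          | zero => rw [pow_zero]; exact Submodule.map_id U
          | succ p ihp =>
            rw [pow_succ, Module.End.mul_eq_comp, Submodule.map_comp, heq, ihp]
        apply hU
        rw [← hpow p, hp, Submodule.map_zero]
      refine ih _ (Submodule.finrank_lt_finrank_of_lt (lt_of_le_of_ne hle hne)) (U.map z)
        (fun hbot => hzv ?_) ?_ rfl
      · have := Submodule.mem_map_of_mem (f := z) hv
        rwa [hbot, Submodule.mem_bot] at this
      · rintro y hy _ ⟨u, hu, rfl⟩
        refine ⟨y u, hSU y hy u hu, ?_⟩
        rw [← Module.End.mul_apply, ← (hcomm y hy z hzS).eq, Module.End.mul_apply]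

/-- A nonzero vector can be moved into the kernel of a nilpotent space of operators `T`
without leaving the kernel of a given family commuting with `T`. -/
theorem exists_kernel_of_pow_eq_bot {V : Type*} [AddCommGroup V] [Module ℂ V]
    (S : Set (Module.End ℂ V)) (T : Submodule ℂ (Module.End ℂ V))
    (hcomm : ∀ y ∈ S, ∀ z ∈ T, Commute y z) {N : ℕ} (hT : T ^ N = ⊥) {v : V} (hv : v ≠ 0)
    (hSv : ∀ z ∈ S, z v = 0) :
    ∃ w ≠ 0, (∀ z ∈ S, z w = 0) ∧ ∀ z ∈ T, z w = 0 := by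
  have hex : ∃ j : ℕ, ∀ q ∈ T ^ j, q v = 0 :=
    ⟨N, fun q hq => by rw [hT, Submodule.mem_bot] at hq; rw [hq, LinearMap.zero_apply]⟩
  classical
  obtain ⟨j, hj⟩ : ∃ j, Nat.find hex = j + 1 := by
    refine Nat.exists_eq_succ_of_ne_zero fun h0 => hv ?_
    have := Nat.find_spec hex
    rw [h0] at this
    simpa using this 1 (one_mem_pow_zero T)
  have hmin := Nat.find_min hex (m := j) (by omega)
  push Not at hmin
  obtain ⟨q, hq, hqv⟩ := hmin
  refine ⟨q v, hqv, fun z hz => ?_, fun z hz => ?_⟩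
  · rw [← Module.End.mul_apply, (commute_of_mem_pow (hcomm z hz) j hq).eq, Module.End.mul_apply, hSv z hz, map_zero]
  · have := Nat.find_spec hex
    rw [hj] at this
    exact this _ (mul_mem_pow_succ hz hq)

/-- The generalized eigenspaces of `u` are preserved by every `x` whose commutator with `u`
commutes with `u`. -/
theorem mapsTo_maxGenEigenspace {V : Type*} [AddCommGroup V] [Module ℂ V]
    {u x z : Module.End ℂ V} (μ : ℂ) (hz : Commute u z) (hx : x * u = u * x + z) {v : V}
    (hv : v ∈ u.maxGenEigenspace μ) : x v ∈ u.maxGenEigenspace μ := by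
  rw [Module.End.mem_maxGenEigenspace] at hv ⊢
  obtain ⟨r, hr⟩ := hv
  have hz' : Commute (u - μ • 1) z := hz.sub_left ((Commute.one_left z).smul_left μ)
  have hx' : x * (u - μ • 1) = (u - μ • 1) * x + z := by
    rw [mul_sub, sub_mul, hx, mul_smul_comm, smul_mul_assoc, mul_one, one_mul]; abel
  have h := congrArg (fun f : Module.End ℂ V => f v) (mul_pow_of_mul_eq hz' hx' r)
  refine ⟨r + 1, ?_⟩
  have hzr : ((u - μ • 1) ^ r * z) v = 0 := by
    rw [(hz'.pow_left r).eq, Module.End.mul_apply, hr, map_zero]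
  have hr1 : ((u - μ • 1) ^ (r + 1)) v = 0 := by
    rw [pow_succ', Module.End.mul_apply, hr, map_zero]
  simp only [Module.End.mul_apply _ x, Module.End.mul_apply x, LinearMap.add_apply, hr1,
    map_zero] at h
  rw [Module.End.mul_apply, hzr, map_zero, add_zero] at h
  exact h.symm

/-! ### Weight modules -/

theorem exists_weightSpace_ne_bot {n : ℕ} {L V : Type*} [LieRing L] [LieAlgebra ℂ L]
    [AddCommGroup V] [Module ℂ V] [LieRingModule L V] [LieModule ℂ L V] [Nontrivial V]
    (d : Fin n → L) (hsup : (⨆ l : Fin n → ℂ, weightSpace (V := V) d l) = ⊤) :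
    ∃ l : Fin n → ℂ, weightSpace (V := V) d l ≠ ⊥ := by
  by_contra! h
  simp [h] at hsup

theorem lie_mem_weightSpace {n : ℕ} {L V : Type*} [LieRing L] [LieAlgebra ℂ L]
    [AddCommGroup V] [Module ℂ V] [LieRingModule L V] [LieModule ℂ L V]
    {d : Fin n → L} {z : L} (hdz : ∀ i, ⁅d i, z⁆ = 0) {l : Fin n → ℂ} {v : V}
    (hv : v ∈ weightSpace d l) : ⁅z, v⁆ ∈ weightSpace d l := by
  intro i
  rw [leibniz_lie, hdz, zero_lie, zero_add, hv i, lie_smul]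

/-- On an irreducible module with weight spaces of dimension at most `N`, an element `z` of
degree zero which commutes with its own commutators is a scalar up to a nilpotent operator. -/
theorem exists_sub_smul_one_pow_eq_zero {n : ℕ} {L V : Type*} [LieRing L] [LieAlgebra ℂ L]
    [AddCommGroup V] [Module ℂ V] [LieRingModule L V] [LieModule ℂ L V]
    (hirr : LieModule.IsIrreducible ℂ L V) {d : Fin n → L}
    (hd : IsHarishChandra (V := V) d) {N : ℕ}
    (hN : ∀ l : Fin n → ℂ, Module.finrank ℂ (weightSpace (V := V) d l) ≤ N) {z : L}
    (hdz : ∀ i, ⁅d i, z⁆ = 0)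
    (hz : ∀ x : L, Commute (LieModule.toEnd ℂ L V z) (LieModule.toEnd ℂ L V ⁅x, z⁆)) :
    ∃ μ : ℂ, (LieModule.toEnd ℂ L V z - μ • 1) ^ N = 0 := by
  obtain ⟨hsup, hfin⟩ := hd
  have hnt : Nontrivial V := (LieSubmodule.nontrivial_iff ℂ L V).1 hirr.toNontrivial
  set u := LieModule.toEnd ℂ L V z
  have hmaps : ∀ l : Fin n → ℂ, ∀ v ∈ weightSpace (V := V) d l, u v ∈ weightSpace d l :=
    fun l v hv => lie_mem_weightSpace hdz hv
  obtain ⟨l, hl⟩ := exists_weightSpace_ne_bot (V := V) d hsup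
  have := hfin l
  have := Submodule.nontrivial_iff_ne_bot.2 hl
  obtain ⟨μ, hμ⟩ := Module.End.exists_eigenvalue (u.restrict (hmaps l))
  obtain ⟨v, hv⟩ := hμ.exists_hasEigenvector
  let G : LieSubmodule ℂ L V :=
    { u.maxGenEigenspace μ with
      lie_mem := fun {x w} hw => by
        refine mapsTo_maxGenEigenspace (x := LieModule.toEnd ℂ L V x) μ (hz x) ?_ hw
        exact LinearMap.ext fun v => (leibniz_lie x z v).trans (add_comm _ _) }
  have hmemG : ∀ w, w ∈ G ↔ w ∈ u.maxGenEigenspace μ := fun w => Iff.rfl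
  have hG : G = ⊤ := by
    refine (hirr.eq_bot_or_eq_top G).resolve_left fun hbot => hv.2 ?_
    have hvG : (v : V) ∈ G := by
      rw [hmemG, Module.End.mem_maxGenEigenspace]
      refine ⟨1, ?_⟩
      have := congrArg Subtype.val hv.apply_eq_smul
      rw [LinearMap.coe_restrict_apply] at this
      simp [this]
    rw [hbot, LieSubmodule.mem_bot] at hvG
    exact Subtype.ext hvG
  refine ⟨μ, ?_⟩
  have hker : (⨆ l : Fin n → ℂ, weightSpace (V := V) d l) ≤
      LinearMap.ker ((u - μ • 1) ^ N) := by
    refine iSup_le fun l v hv => ?_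
    have := hfin l
    have hvG : v ∈ u.maxGenEigenspace μ := (hmemG v).1 (hG ▸ LieSubmodule.mem_top v)
    have h1 : (⟨v, hv⟩ : weightSpace (V := V) d l) ∈
        Module.End.maxGenEigenspace (u.restrict (hmaps l)) μ := by
      rw [Module.End.maxGenEigenspace, Module.End.genEigenspace_restrict]
      exact hvG
    rw [Module.End.maxGenEigenspace_eq_genEigenspace_finrank,
      Module.End.genEigenspace_restrict, Submodule.mem_comap] at h1
    have h2 := (u.genEigenspace μ).mono (Nat.cast_le.2 (hN l)) h1
    exact Module.End.mem_genEigenspace_nat.1 h2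
  rw [hsup, top_le_iff, LinearMap.ker_eq_top] at hker
  exact hker

/-! ### The grading of the full toroidal Lie algebra -/

theorem lie_mem_gradedPiece {κ : 𝔤 →ₗ[ℂ] 𝔤 →ₗ[ℂ] ℂ} {c₁ c₂ : ℂ}
    {E : (Fin n → ℤ) → 𝔤 →ₗ[ℂ] τ} {K W : (Fin n → ℤ) → Fin n → τ}
    (hτ : IsFullToroidal n 𝔤 τ κ c₁ c₂ E K W) {m k : Fin n → ℤ} {X Y : τ}
    (hX : X ∈ gradedPiece E K W m) (hY : Y ∈ gradedPiece E K W k) :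
    ⁅X, Y⁆ ∈ gradedPiece E K W (m + k) := by
  have hE : ∀ m x, E m x ∈ gradedPiece E K W m := fun m x =>
    Submodule.subset_span (Or.inl (Or.inl ⟨x, rfl⟩))
  have hK : ∀ m i, K m i ∈ gradedPiece E K W m := fun m i =>
    Submodule.subset_span (Or.inl (Or.inr ⟨i, rfl⟩))
  have hW : ∀ m i, W m i ∈ gradedPiece E K W m := fun m i =>
    Submodule.subset_span (Or.inr ⟨i, rfl⟩)
  have hsum : ∀ m k : Fin n → ℤ, ∑ p, (m p : ℂ) • K k p ∈ gradedPiece E K W k := fun m k =>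
    Submodule.sum_mem _ fun p _ => Submodule.smul_mem _ _ (hK k p)
  have hWK : ∀ m i k j, ⁅W m i, K k j⁆ ∈ gradedPiece E K W (m + k) := by
    intro m i k j
    rw [hτ.lie_W_K]
    refine add_mem (Submodule.smul_mem _ _ (hK _ _)) ?_
    split_ifs
    · exact hsum _ _
    · exact zero_mem _
  have hWE : ∀ m i k x, ⁅W m i, E k x⁆ ∈ gradedPiece E K W (m + k) := by
    intro m i k x
    rw [hτ.lie_W_E]
    exact Submodule.smul_mem _ _ (hE _ _)
  induction hX using Submodule.span_induction with
  | zero => rw [zero_lie]; exact zero_mem _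
  | add X X' _ _ h h' => rw [add_lie]; exact add_mem h h'
  | smul c X _ h => rw [smul_lie]; exact Submodule.smul_mem _ _ h
  | mem X hX =>
    induction hY using Submodule.span_induction with
    | zero => rw [lie_zero]; exact zero_mem _
    | add Y Y' _ _ h h' => rw [lie_add]; exact add_mem h h'
    | smul c Y _ h => rw [lie_smul]; exact Submodule.smul_mem _ _ h
    | mem Y hY =>
      obtain (⟨x, rfl⟩ | ⟨i, rfl⟩) | ⟨i, rfl⟩ := hX <;>
        obtain (⟨y, rfl⟩ | ⟨j, rfl⟩) | ⟨j, rfl⟩ := hY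
      · rw [hτ.lie_E_E]
        exact add_mem (hE _ _) (Submodule.smul_mem _ _ (hsum _ _))
      · rw [hτ.lie_E_K]; exact zero_mem _
      · rw [← lie_skew, add_comm]; exact neg_mem (hWE _ _ _ _)
      · rw [← lie_skew, hτ.lie_E_K, neg_zero]; exact zero_mem _
      · rw [hτ.lie_K_K]; exact zero_mem _
      · rw [← lie_skew, add_comm]; exact neg_mem (hWK _ _ _ _)
      · exact hWE _ _ _ _
      · exact hWK _ _ _ _
      · rw [hτ.lie_W_W]
        exact add_mem (sub_mem (Submodule.smul_mem _ _ (hW _ _))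
          (Submodule.smul_mem _ _ (hW _ _))) (Submodule.smul_mem _ _ (hsum _ _))

theorem lie_degree_of_mem_gradedPiece {κ : 𝔤 →ₗ[ℂ] 𝔤 →ₗ[ℂ] ℂ} {c₁ c₂ : ℂ}
    {E : (Fin n → ℤ) → 𝔤 →ₗ[ℂ] τ} {K W : (Fin n → ℤ) → Fin n → τ}
    (hτ : IsFullToroidal n 𝔤 τ κ c₁ c₂ E K W) {m : Fin n → ℤ} (i : Fin n) {X : τ}
    (hX : X ∈ gradedPiece E K W m) : ⁅W 0 i, X⁆ = (m i : ℂ) • X := by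
  induction hX using Submodule.span_induction with
  | zero => simp
  | add X X' _ _ h h' => rw [lie_add, h, h', smul_add]
  | smul c X _ h => rw [lie_smul, h, smul_comm]
  | mem X hX =>
    obtain (⟨x, rfl⟩ | ⟨j, rfl⟩) | ⟨j, rfl⟩ := hX
    · simp [hτ.lie_W_E]
    · simp [hτ.lie_W_K]
    · simp [hτ.lie_W_W]

/-- Every generator of degree zero is, up to sign, a commutator with `t^m d_i` of a generator
of degree `-m`, for some `m ≠ 0`. -/
theorem exists_lie_eq_neg_of_genOfDeg_zero {κ : 𝔤 →ₗ[ℂ] 𝔤 →ₗ[ℂ] ℂ} {c₁ c₂ : ℂ}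
    {E : (Fin n → ℤ) → 𝔤 →ₗ[ℂ] τ} {K W : (Fin n → ℤ) → Fin n → τ}
    (hn : 2 ≤ n) (hτ : IsFullToroidal n 𝔤 τ κ c₁ c₂ E K W) {X : τ}
    (hX : X ∈ genOfDeg E K W 0) :
    ∃ m ≠ 0, ∃ L : τ, ∃ Y ∈ genOfDeg E K W m, ⁅L, Y⁆ = -X := by
  have hm : ∀ i : Fin n, -(Pi.single i 1 : Fin n → ℤ) ≠ 0 := by
    intro i h
    have := congrFun h i
    simp at this
  have hne : ∀ j : Fin n, ∃ i : Fin n, i ≠ j := by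
    have : Nontrivial (Fin n) := Fin.nontrivial_iff_two_le.2 hn
    exact fun j => exists_ne j
  obtain (⟨x, rfl⟩ | ⟨j, rfl⟩) | ⟨j, rfl⟩ := hX
  · let i : Fin n := ⟨0, by omega⟩
    refine ⟨_, hm i, W (Pi.single i 1) i, E (-Pi.single i 1) x, Or.inl (Or.inl ⟨x, rfl⟩), ?_⟩
    rw [hτ.lie_W_E]
    simp
  · obtain ⟨i, hij⟩ := hne j
    refine ⟨_, hm i, W (Pi.single i 1) i, K (-Pi.single i 1) j, Or.inl (Or.inr ⟨j, rfl⟩), ?_⟩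
    rw [hτ.lie_W_K, if_neg hij]
    simp
  · obtain ⟨i, hij⟩ := hne j
    refine ⟨_, hm i, W (Pi.single i 1) i, W (-Pi.single i 1) j, Or.inr ⟨j, rfl⟩, ?_⟩
    rw [hτ.lie_W_W]
    simp [hij.symm]

/-! ### Square-zero ideals act trivially -/

theorem toEnd_tmul_mul {B V : Type} [CommRing B] [Algebra ℂ B] [AddCommGroup V] [Module ℂ V]
    [LieRingModule (B ⊗[ℂ] τ) V] [LieModule ℂ (B ⊗[ℂ] τ) V] (b c : B) (X Y : τ) :
    LieModule.toEnd ℂ (B ⊗[ℂ] τ) V (b ⊗ₜ X) * LieModule.toEnd ℂ (B ⊗[ℂ] τ) V (c ⊗ₜ Y) =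
      LieModule.toEnd ℂ (B ⊗[ℂ] τ) V (c ⊗ₜ Y) * LieModule.toEnd ℂ (B ⊗[ℂ] τ) V (b ⊗ₜ X) +
        LieModule.toEnd ℂ (B ⊗[ℂ] τ) V ((b * c) ⊗ₜ ⁅X, Y⁆) := by
  rw [← LieAlgebra.ExtendScalars.bracket_tmul]
  exact LinearMap.ext fun v => (leibniz_lie _ _ v).trans (add_comm _ _)

theorem lie_tmul_eq_zero_of_sq {κ : 𝔤 →ₗ[ℂ] 𝔤 →ₗ[ℂ] ℂ} {c₁ c₂ : ℂ}
    {E : (Fin n → ℤ) → 𝔤 →ₗ[ℂ] τ} {K W : (Fin n → ℤ) → Fin n → τ}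
    (hn : 2 ≤ n) (hτ : IsFullToroidal n 𝔤 τ κ c₁ c₂ E K W)
    {B V : Type} [CommRing B] [Algebra ℂ B] [AddCommGroup V] [Module ℂ V]
    [LieRingModule (B ⊗[ℂ] τ) V] [LieModule ℂ (B ⊗[ℂ] τ) V]
    (hirr : LieModule.IsIrreducible ℂ (B ⊗[ℂ] τ) V)
    (hcusp : IsCuspidal (V := V) (dOp B W)) {a : B}
    (ha : ∀ (X : τ) (b : B) (v : V), ⁅(a * a * b) ⊗ₜ[ℂ] X, v⁆ = 0) (X : τ) (v : V) :
    ⁅a ⊗ₜ[ℂ] X, v⁆ = 0 := by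
  obtain ⟨hHC, N, hN⟩ := hcusp
  have hnt : Nontrivial V :=
    (LieSubmodule.nontrivial_iff ℂ (B ⊗[ℂ] τ) V).1 hirr.toNontrivial
  let ρ : B → τ → Module.End ℂ V := fun b X => LieModule.toEnd ℂ (B ⊗[ℂ] τ) V (b ⊗ₜ X)
  have hρ : ∀ b c X Y, ρ b X * ρ c Y = ρ c Y * ρ b X + ρ (b * c) ⁅X, Y⁆ := toEnd_tmul_mul
  have hρsmul : ∀ b (c : ℂ) X, ρ b (c • X) = c • ρ b X := by
    intro b c X
    change LieModule.toEnd ℂ (B ⊗[ℂ] τ) V (b ⊗ₜ (c • X)) = _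
    rw [TensorProduct.tmul_smul, map_smul]
  have hcomm : ∀ b c X Y, Commute (ρ (a * b) X) (ρ (a * c) Y) := by
    intro b c X Y
    have h0 : ρ (a * b * (a * c)) ⁅X, Y⁆ = 0 := by
      rw [show a * b * (a * c) = a * a * (b * c) by ring]
      exact LinearMap.ext fun v => ha _ _ v
    have := hρ (a * b) (a * c) X Y
    rwa [h0, add_zero] at this
  have hdeg : ∀ (b : B) (i : Fin n), ∀ X ∈ gradedPiece E K W 0,
      ⁅dOp B W i, b ⊗ₜ[ℂ] X⁆ = 0 := by
    intro b i X hX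
    rw [dOp, LieAlgebra.ExtendScalars.bracket_tmul, lie_degree_of_mem_gradedPiece hτ i hX]
    simp
  have hW0 : ∀ i, W 0 i ∈ gradedPiece E K W 0 := fun i =>
    Submodule.subset_span (Or.inr ⟨i, rfl⟩)
  -- The operators of degree `m` with `s * m i > 0`.
  let S : Fin n × ℤˣ → Set (Module.End ℂ V) := fun q =>
    {f | ∃ m : Fin n → ℤ, 0 < (q.2 : ℤ) * m q.1 ∧ ∃ X ∈ gradedPiece E K W m, ∃ b : B,
      f = ρ (a * b) X}
  have hSnil : ∀ q, Submodule.span ℂ (S q) ^ N = ⊥ := by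
    rintro ⟨i, s⟩
    obtain ⟨μ, hμ⟩ := exists_sub_smul_one_pow_eq_zero hirr hHC hN
      (z := a ⊗ₜ[ℂ] W 0 i) (fun j => hdeg a j _ (hW0 i)) (by
        intro x
        induction x using TensorProduct.induction_on with
        | zero => rw [zero_lie, map_zero]; exact Commute.zero_right _
        | add x y hx hy => rw [add_lie, map_add]; exact hx.add_right hy
        | tmul b X =>
          rw [LieAlgebra.ExtendScalars.bracket_tmul, mul_comm b a]
          simpa [ρ] using hcomm 1 b (W 0 i) ⁅X, W 0 i⁆)
    refine pow_eq_bot_of_commutator hμ ?_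
    rintro _ ⟨m, hm, X, hX, b, rfl⟩
    have hm0 : m i ≠ 0 := by
      intro h0
      simp [h0] at hm
    refine ⟨?_, ρ b X, -(m i : ℂ), by simpa using hm0, ?_, ?_⟩
    · refine Commute.sub_left ?_ ((Commute.one_left _).smul_left μ)
      simpa [ρ] using hcomm 1 b (W 0 i) X
    · have h1 := hρ b a X (W 0 i)
      rw [← lie_skew, lie_degree_of_mem_gradedPiece hτ i hX, ← neg_smul, hρsmul,
        mul_comm b a] at h1
      change ρ b X * (ρ a (W 0 i) - μ • 1) = (ρ a (W 0 i) - μ • 1) * ρ b X + _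
      rw [mul_sub, sub_mul, h1, mul_smul_comm, smul_mul_assoc, mul_one, one_mul]
      abel
    · intro y hy
      induction hy using Submodule.span_induction with
      | zero => simp
      | add y z _ _ hy hz =>
        rw [show ρ b X * (y + z) - (y + z) * ρ b X
          = (ρ b X * y - y * ρ b X) + (ρ b X * z - z * ρ b X) by noncomm_ring]
        exact add_mem hy hz
      | smul c y _ hy =>
        rw [mul_smul_comm, smul_mul_assoc, ← smul_sub]
        exact Submodule.smul_mem _ _ hy
      | mem y hy =>
        obtain ⟨k, hk, Y, hY, c, rfl⟩ := hy
        refine Submodule.subset_span ⟨m + k, ?_, ⁅X, Y⁆, lie_mem_gradedPiece hτ hX hY, b * c, ?_⟩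
        · rw [Pi.add_apply, mul_add]
          exact add_pos hm hk
        · rw [hρ, add_sub_cancel_left, mul_left_comm]
  have hcover : ∀ m : Fin n → ℤ, m ≠ 0 → ∀ b, ∀ X ∈ genOfDeg E K W m,
      ∃ q, ρ (a * b) X ∈ S q := by
    intro m hm b X hX
    obtain ⟨i, hi⟩ := Function.ne_iff.1 hm
    rcases lt_or_gt_of_ne hi with h | h
    · exact ⟨(i, -1), m, by simpa using h, X, Submodule.subset_span hX, b, rfl⟩
    · exact ⟨(i, 1), m, by simpa using h, X, Submodule.subset_span hX, b, rfl⟩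
  let S0 : Set (Module.End ℂ V) := {f | ∃ X ∈ genOfDeg E K W 0, ∃ b : B, f = ρ (a * b) X}
  have hS0nil : ∀ z ∈ S0, IsNilpotent z := by
    rintro _ ⟨X, hX, b, rfl⟩
    obtain ⟨m, hm, L, Y, hY, hLY⟩ := exists_lie_eq_neg_of_genOfDeg_zero hn hτ hX
    obtain ⟨q, hq⟩ := hcover m hm b Y hY
    have hYnil : IsNilpotent (ρ (a * b) Y) := by
      refine ⟨N, ?_⟩
      have := Submodule.pow_mem_pow (Submodule.span ℂ (S q)) (Submodule.subset_span hq) N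
      rwa [hSnil q, Submodule.mem_bot] at this
    have h1 := hρ 1 (a * b) L Y
    have h2 := hρ 1 (a * b) L (-X)
    rw [one_mul] at h1 h2
    rw [hLY] at h1
    have h3 := isNilpotent_of_mul_eq (hcomm b b Y (-X)) (hcomm b b (-X) _) h1 h2 hYnil
    have h4 : ρ (a * b) (-X) = -ρ (a * b) X := by
      rw [← neg_one_smul ℂ X, hρsmul, neg_one_smul]
    rwa [h4, isNilpotent_neg_iff] at h3
  obtain ⟨l, hl⟩ := exists_weightSpace_ne_bot (V := V) (dOp B W) hHC.1
  have := hHC.2 l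
  obtain ⟨v₀, hv₀, hS0v₀⟩ := exists_common_kernel S0
    (by rintro _ ⟨X, -, b, rfl⟩ _ ⟨Y, -, c, rfl⟩; exact hcomm b c X Y) hS0nil _ hl
    (by
      rintro _ ⟨X, hX, b, rfl⟩ v hv
      exact lie_mem_weightSpace (fun i => hdeg (a * b) i X (Submodule.subset_span hX)) hv)
  have hfam : ∀ F : Finset (Fin n × ℤˣ), ∃ w : V, w ≠ 0 ∧ (∀ z ∈ S0, z w = 0) ∧
      ∀ q ∈ F, ∀ z ∈ S q, z w = 0 := by
    classical
    intro F
    induction F using Finset.induction_on with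
    | empty => exact ⟨v₀, hv₀, hS0v₀, by simp⟩
    | insert q F _ ih =>
      obtain ⟨w, hw, hS0w, hFw⟩ := ih
      let S' : Set (Module.End ℂ V) := S0 ∪ {z | ∃ q ∈ F, z ∈ S q}
      obtain ⟨w', hw', hS', hT⟩ := exists_kernel_of_pow_eq_bot S' (Submodule.span ℂ (S q))
        (by
          intro y hy z hz
          obtain ⟨Y, c, rfl⟩ : ∃ Y c, y = ρ (a * c) Y := by
            rcases hy with ⟨Y, -, c, rfl⟩ | ⟨_, -, _, -, Y, -, c, rfl⟩ <;> exact ⟨Y, c, rfl⟩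
          induction hz using Submodule.span_induction with
          | zero => exact Commute.zero_right _
          | add z z' _ _ h h' => exact h.add_right h'
          | smul t z _ h => exact h.smul_right t
          | mem z hz =>
            obtain ⟨_, -, Z, -, b, rfl⟩ := hz
            exact hcomm c b Y Z) (hSnil q) hw
        (by
          rintro z (hz | ⟨q, hq, hz⟩)
          · exact hS0w z hz
          · exact hFw q hq z hz)
      refine ⟨w', hw', fun z hz => hS' z (Or.inl hz), fun p hp z hz => ?_⟩
      rcases Finset.mem_insert.1 hp with rfl | hp
      · exact hT z (Submodule.subset_span hz)
      · exact hS' z (Or.inr ⟨p, hp, hz⟩)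
  obtain ⟨w, hw, hS0w, hSw⟩ := hfam Finset.univ
  let Q : LieSubmodule ℂ (B ⊗[ℂ] τ) V :=
    { carrier := {v | ∀ X b, ρ (a * b) X v = 0}
      add_mem' := fun hv hv' X b => by rw [map_add, hv, hv', add_zero]
      zero_mem' := fun X b => map_zero _
      smul_mem' := fun c v hv X b => by rw [map_smul, hv, smul_zero]
      lie_mem := fun {x v} hv X b => by
        induction x using TensorProduct.induction_on with
        | zero => rw [zero_lie, map_zero]
        | add x y hx hy => rw [add_lie, map_add, hx, hy, add_zero]
        | tmul c Y =>
          have h := congrArg (fun f : Module.End ℂ V => f v) (hρ (a * b) c X Y)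
          rw [mul_assoc] at h
          simp only [Module.End.mul_apply, LinearMap.add_apply] at h
          rw [hv, hv, map_zero, add_zero] at h
          exact h }
  have hwQ : w ∈ Q := by
    intro X b
    have hX : X ∈ Submodule.span ℂ ({z : τ | ∃ m x, z = E m x} ∪ {z : τ | ∃ m i, z = K m i} ∪
        {z : τ | ∃ m i, z = W m i}) := by
      rw [hτ.span_eq_top]
      exact Submodule.mem_top
    induction hX using Submodule.span_induction with
    | zero => simp [ρ]
    | add X Y _ _ hX hY =>
      have : ρ (a * b) (X + Y) = ρ (a * b) X + ρ (a * b) Y := by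
        simp only [ρ, TensorProduct.tmul_add, map_add]
      rw [this, LinearMap.add_apply, hX, hY, add_zero]
    | smul c X _ hX => rw [hρsmul, LinearMap.smul_apply, hX, smul_zero]
    | mem X hX =>
      obtain ⟨m, hm⟩ : ∃ m, X ∈ genOfDeg E K W m := by
        obtain (⟨m, x, rfl⟩ | ⟨m, i, rfl⟩) | ⟨m, i, rfl⟩ := hX
        · exact ⟨m, Or.inl (Or.inl ⟨x, rfl⟩)⟩
        · exact ⟨m, Or.inl (Or.inr ⟨i, rfl⟩)⟩
        · exact ⟨m, Or.inr ⟨i, rfl⟩⟩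
      by_cases hm0 : m = 0
      · subst hm0
        exact hS0w _ ⟨X, hm, b, rfl⟩
      · obtain ⟨q, hq⟩ := hcover m hm0 b X hm
        exact hSw q (Finset.mem_univ q) _ hq
  have hQ : Q = ⊤ := by
    refine (hirr.eq_bot_or_eq_top Q).resolve_left fun hbot => hw ?_
    rwa [hbot, LieSubmodule.mem_bot] at hwQ
  have hv : v ∈ Q := hQ ▸ LieSubmodule.mem_top v
  have := hv X 1
  rwa [mul_one] at this

theorem statement_11
    (n : ℕ) (hn : 3 ≤ n)
    (𝔤 : Type) [LieRing 𝔤] [LieAlgebra ℂ 𝔤] [LieAlgebra.IsSimple ℂ 𝔤]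
    [FiniteDimensional ℂ 𝔤]
    (τ : Type) [LieRing τ] [LieAlgebra ℂ τ]
    (κ : 𝔤 →ₗ[ℂ] 𝔤 →ₗ[ℂ] ℂ) (c₁ c₂ : ℂ)
    (E : (Fin n → ℤ) → 𝔤 →ₗ[ℂ] τ) (K W : (Fin n → ℤ) → Fin n → τ)
    (hτ : IsFullToroidal n 𝔤 τ κ c₁ c₂ E K W)
    (B : Type) [CommRing B] [Algebra ℂ B] [Nontrivial B]
    (hB : Algebra.FiniteType ℂ B)
    (V : Type) [AddCommGroup V] [Module ℂ V]
    [LieRingModule (B ⊗[ℂ] τ) V] [LieModule ℂ (B ⊗[ℂ] τ) V]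
    (hirr : LieModule.IsIrreducible ℂ (B ⊗[ℂ] τ) V)
    (hcusp : IsCuspidal (V := V) (dOp B W))
    (𝔐 : Ideal B) (hcf : FiniteDimensional ℂ (B ⧸ 𝔐))
    (k : ℕ) (hk : 0 < k) (hann : annTensor τ B (𝔐 ^ k) V) :
    annTensor τ B 𝔐 V := by
  obtain ⟨j, rfl⟩ : ∃ j, k = j + 1 := ⟨k - 1, by omega⟩
  induction j with
  | zero => simpa using hann
  | succ j ih =>
    refine ih (Nat.succ_pos j) fun X a ha v => ?_
    refine lie_tmul_eq_zero_of_sq (by omega) hτ hirr hcusp (fun Y b w => hann Y _ ?_ w) X v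
    refine Ideal.mul_mem_right b _ ?_
    have h := Ideal.mul_mem_mul ha ha
    rw [← pow_add] at h
    exact Ideal.pow_le_pow_right (by omega) h

end MT
end

section
/- Let V be an irreducible cuspidal Harish-Chandra module over τ(B), let 𝔐 be an ideal of B with (τ ⊗ 𝔐²)·V = 0, and let N be a bound on the dimensions of the weight spaces of V. Assume that (d_i ⊗ b)^N·V = 0 for all 1 ≤ i ≤ n and b ∈ 𝔐. Then for all 1 ≤ i ≤ n, all p ∈ ℤ, and all b ∈ 𝔐 one has (t_i^p d_i ⊗ b)^N·V = 0. -/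
open scoped TensorProduct

namespace MT

variable {n : ℕ} {𝔤 : Type} [LieRing 𝔤] [LieAlgebra ℂ 𝔤]
variable {τ : Type} [LieRing τ] [LieAlgebra ℂ τ]

/-- If `[D, S] = c T` with `c` invertible and `D, S, T` otherwise commute, then
`S ^ N = 0` forces `T ^ N = 0`. -/
theorem pow_eq_zero_of_commutator {R : Type*} [Ring R] [Algebra ℂ R] {D S T : R} {c : ℂ}
    (hc : c ≠ 0) (hDS : D * S = S * D + c • T) (hDT : Commute D T) (hST : Commute S T)
    {N : ℕ} (hS : S ^ N = 0) : T ^ N = 0 := by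
  have hpow : ∀ k : ℕ, D * S ^ k = S ^ k * D + ((k : ℂ) * c) • (S ^ (k - 1) * T) := by
    intro k
    induction k with
    | zero => simp
    | succ k ih =>
      have hTS : S ^ (k - 1) * T * S = S ^ (k - 1) * S * T := by
        rw [mul_assoc, ← hST.eq, mul_assoc]
      rw [pow_succ, ← mul_assoc, ih, add_mul, mul_assoc, hDS, mul_add, smul_mul_assoc, hTS,
        mul_smul_comm, add_assoc, mul_assoc, Nat.add_sub_cancel]
      rcases k with _ | k
      · simp
      · rw [Nat.add_sub_cancel, ← mul_assoc, ← pow_succ, ← mul_assoc (S ^ k), ← pow_succ, ← add_smul]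
        congr 2
        push_cast
        ring
  have key : ∀ k j : ℕ, k + j = N → S ^ k * T ^ j = 0 := by
    intro k j
    induction j generalizing k with
    | zero =>
      rintro rfl
      simpa using hS
    | succ j ih =>
      intro h
      have h0 := ih (k + 1) (by omega)
      have h1 : D * (S ^ (k + 1) * T ^ j) = S ^ (k + 1) * T ^ j * D
          + (((k + 1 : ℕ) : ℂ) * c) • (S ^ k * T ^ (j + 1)) := by
        rw [← mul_assoc, hpow, add_mul, mul_assoc, (hDT.pow_right j).eq, smul_mul_assoc,
          Nat.add_sub_cancel, mul_assoc _ T, ← pow_succ', mul_assoc]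
      rw [h0, mul_zero, zero_mul, zero_add] at h1
      have hk : ((k + 1 : ℕ) : ℂ) * c ≠ 0 := mul_ne_zero (Nat.cast_ne_zero.2 k.succ_ne_zero) hc
      exact (smul_eq_zero_iff_right hk).1 h1.symm
  simpa using key 0 N (by simp)

section

variable {κ : 𝔤 →ₗ[ℂ] 𝔤 →ₗ[ℂ] ℂ} {c₁ c₂ : ℂ} {E : (Fin n → ℤ) → 𝔤 →ₗ[ℂ] τ}
  {K W : (Fin n → ℤ) → Fin n → τ}

theorem IsFullToroidal.lie_W_single_W_zero (hτ : IsFullToroidal n 𝔤 τ κ c₁ c₂ E K W)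
    (i : Fin n) (p : ℤ) :
    ⁅W (Pi.single i p) i, W 0 i⁆ = -(p : ℂ) • W (Pi.single i p) i := by
  simp [hτ.lie_W_W]

end

theorem statement_12
    (n : ℕ) (hn : 3 ≤ n)
    (𝔤 : Type) [LieRing 𝔤] [LieAlgebra ℂ 𝔤] [LieAlgebra.IsSimple ℂ 𝔤]
    [FiniteDimensional ℂ 𝔤]
    (τ : Type) [LieRing τ] [LieAlgebra ℂ τ]
    (κ : 𝔤 →ₗ[ℂ] 𝔤 →ₗ[ℂ] ℂ) (c₁ c₂ : ℂ)
    (E : (Fin n → ℤ) → 𝔤 →ₗ[ℂ] τ) (K W : (Fin n → ℤ) → Fin n → τ)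
    (hτ : IsFullToroidal n 𝔤 τ κ c₁ c₂ E K W)
    (B : Type) [CommRing B] [Algebra ℂ B] [Nontrivial B]
    (hB : Algebra.FiniteType ℂ B)
    (V : Type) [AddCommGroup V] [Module ℂ V]
    [LieRingModule (B ⊗[ℂ] τ) V] [LieModule ℂ (B ⊗[ℂ] τ) V]
    (hirr : LieModule.IsIrreducible ℂ (B ⊗[ℂ] τ) V)
    (hcusp : IsCuspidal (V := V) (dOp B W))
    (𝔐 : Ideal B) (hann : annTensor τ B (𝔐 ^ 2) V)
    (N : ℕ)
    (hbound : ∀ l : Fin n → ℂ, Module.finrank ℂ (weightSpace (V := V) (dOp B W) l) ≤ N)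
    (hd : ∀ i : Fin n, ∀ b ∈ 𝔐, ∀ v : V,
      (fun w : V => ⁅b ⊗ₜ[ℂ] W 0 i, w⁆)^[N] v = 0) :
    ∀ (i : Fin n) (p : ℤ), ∀ b ∈ 𝔐, ∀ v : V,
      (fun w : V => ⁅b ⊗ₜ[ℂ] W (Pi.single i p) i, w⁆)^[N] v = 0 := by
  intro i p b hb
  rcases eq_or_ne p 0 with rfl | hp
  · rw [Pi.single_zero]
    exact hd i b hb
  set D := LieModule.toEnd ℂ (B ⊗[ℂ] τ) V ((1 : B) ⊗ₜ[ℂ] W (Pi.single i p) i)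
  set S := LieModule.toEnd ℂ (B ⊗[ℂ] τ) V (b ⊗ₜ[ℂ] W 0 i)
  set T := LieModule.toEnd ℂ (B ⊗[ℂ] τ) V (b ⊗ₜ[ℂ] W (Pi.single i p) i)
  have hSN : S ^ N = 0 := by
    ext v
    rw [Module.End.pow_apply]
    exact hd i b hb v
  have hDS : D * S = S * D + (-(p : ℂ)) • T := by
    ext v
    change ⁅(1 : B) ⊗ₜ[ℂ] W (Pi.single i p) i, ⁅b ⊗ₜ[ℂ] W 0 i, v⁆⁆
      = ⁅b ⊗ₜ[ℂ] W 0 i, ⁅(1 : B) ⊗ₜ[ℂ] W (Pi.single i p) i, v⁆⁆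
        + (-(p : ℂ)) • ⁅b ⊗ₜ[ℂ] W (Pi.single i p) i, v⁆
    rw [leibniz_lie, LieAlgebra.ExtendScalars.bracket_tmul, one_mul,
      hτ.lie_W_single_W_zero, TensorProduct.tmul_smul, smul_lie, add_comm]
  have hDT : Commute D T := by
    ext v
    change ⁅(1 : B) ⊗ₜ[ℂ] W (Pi.single i p) i, ⁅b ⊗ₜ[ℂ] W (Pi.single i p) i, v⁆⁆
      = ⁅b ⊗ₜ[ℂ] W (Pi.single i p) i, ⁅(1 : B) ⊗ₜ[ℂ] W (Pi.single i p) i, v⁆⁆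
    rw [leibniz_lie, LieAlgebra.ExtendScalars.bracket_tmul, lie_self, TensorProduct.tmul_zero,
      zero_lie, zero_add]
  have hST : Commute S T := by
    ext v
    change ⁅b ⊗ₜ[ℂ] W 0 i, ⁅b ⊗ₜ[ℂ] W (Pi.single i p) i, v⁆⁆
      = ⁅b ⊗ₜ[ℂ] W (Pi.single i p) i, ⁅b ⊗ₜ[ℂ] W 0 i, v⁆⁆
    rw [leibniz_lie, LieAlgebra.ExtendScalars.bracket_tmul,
      hann _ _ (pow_two 𝔐 ▸ Ideal.mul_mem_mul hb hb), zero_add]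
  have hTN : T ^ N = 0 :=
    pow_eq_zero_of_commutator (neg_ne_zero.2 (Int.cast_ne_zero.2 hp)) hDS hDT hST hSN
  intro v
  have h := congrArg (fun f : Module.End ℂ V => f v) hTN
  simp only [Module.End.pow_apply, LinearMap.zero_apply] at h
  exact h

end MT
end

section
/- Let V be an irreducible cuspidal Harish-Chandra module over τ(B), let 𝔐 be an ideal of B with (τ ⊗ 𝔐²)·V = 0, fix 1 ≤ i ≤ n and N ∈ ℕ, and assume (t_i^p d_i ⊗ a)^N·V = 0 for all p ∈ ℤ and a ∈ 𝔐. Then for every 0 ≤ r ≤ N, every a ∈ 𝔐, all m^{(1)},…,m^{(r)} ∈ ℤ^n, and every integer p > max{ m_i^{(j)} : 1 ≤ j ≤ r }, one has (t^{m^{(1)}}d_i ⊗ a)(t^{m^{(2)}}d_i ⊗ a)⋯(t^{m^{(r)}}d_i ⊗ a)(t_i^p d_i ⊗ a)^{N−r}·V = 0. -/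
open scoped TensorProduct

namespace MT

variable {n : ℕ} {𝔤 : Type} [LieRing 𝔤] [LieAlgebra ℂ 𝔤]
variable {τ : Type} [LieRing τ] [LieAlgebra ℂ τ]

section Commutators

variable {A : Type*} [Ring A] [Algebra ℂ A]

theorem one_mem_pow_zero_s13 (M : Submodule ℂ A) : (1 : A) ∈ M ^ 0 := by
  rw [pow_zero]; exact Submodule.one_le.1 le_rfl

theorem mul_mem_pow_succ_s13 {M : Submodule ℂ A} {r : ℕ} {x P : A} (hx : x ∈ M) (hP : P ∈ M ^ r) :
    x * P ∈ M ^ (r + 1) := by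
  rw [pow_succ']; exact Submodule.mul_mem_mul hx hP

theorem mul_pow_mem_pow {M : Submodule ℂ A} {r N : ℕ} (hr : r ≤ N) {x P : A} (hP : P ∈ M ^ r)
    (hx : x ∈ M) : P * x ^ (N - r) ∈ M ^ N := by
  rw [← pow_mul_pow_sub M hr]
  exact Submodule.mul_mem_mul hP (Submodule.pow_mem_pow _ hx _)

theorem lie_mem_pow {M M' : Submodule ℂ A} (hle : M ≤ M') {y : A}
    (h : ∀ x ∈ M, ⁅y, x⁆ ∈ M') {r : ℕ} {P : A} (hP : P ∈ M ^ r) : ⁅y, P⁆ ∈ M' ^ r := by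
  induction hP using Submodule.pow_induction_on_right' with
  | algebraMap c => simp [Ring.lie_def, Algebra.commutes]
  | add x z i hx hz hx' hz' =>
    have e : ⁅y, x + z⁆ = ⁅y, x⁆ + ⁅y, z⁆ := by simp only [Ring.lie_def]; noncomm_ring
    rw [e]; exact add_mem hx' hz'
  | mul_mem i x hx ih m hm =>
    have e : ⁅y, x * m⁆ = ⁅y, x⁆ * m + x * ⁅y, m⁆ := by simp only [Ring.lie_def]; noncomm_ring
    rw [e, pow_succ]
    exact add_mem (Submodule.mul_mem_mul ih (hle hm))
      (Submodule.mul_mem_mul (pow_le_pow_left' hle i hx) (h m hm))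

theorem lie_mem_of_mem_span {S : Set A} {M : Submodule ℂ A} {y : A}
    (h : ∀ x ∈ S, ⁅y, x⁆ ∈ M) {x : A} (hx : x ∈ Submodule.span ℂ S) : ⁅y, x⁆ ∈ M := by
  induction hx using Submodule.span_induction with
  | mem x hx => exact h x hx
  | zero => simp [Ring.lie_def]
  | add x z _ _ hx hz =>
    have e : ⁅y, x + z⁆ = ⁅y, x⁆ + ⁅y, z⁆ := by simp only [Ring.lie_def]; noncomm_ring
    rw [e]; exact add_mem hx hz
  | smul c x _ hx =>
    have e : ⁅y, c • x⁆ = c • ⁅y, x⁆ := by simp [Ring.lie_def, smul_sub]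
    rw [e]; exact M.smul_mem c hx

theorem lie_pow_succ {X y Z : A} (hZ : ⁅y, X⁆ = Z) (hZX : Commute Z X) (s : ℕ) :
    ⁅y, X ^ (s + 1)⁆ = ((s : ℂ) + 1) • (Z * X ^ s) := by
  induction s with
  | zero => simp [hZ]
  | succ s ih =>
    have e : ⁅y, X ^ (s + 1) * X⁆ = ⁅y, X ^ (s + 1)⁆ * X + X ^ (s + 1) * ⁅y, X⁆ := by
      simp only [Ring.lie_def]; noncomm_ring
    rw [pow_succ X (s + 1), e, ih, hZ, ← (hZX.pow_right (s + 1)).eq, smul_mul_assoc, mul_assoc,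
      ← pow_succ]
    push_cast
    module

/-- If every element of `S` is, up to a nonzero scalar, a commutator `⁅y, X⁆` commuting with the
nilpotent element `X`, where `y` normalizes the span of `S`, then the factors of `X ^ N = 0` may be
replaced one by one by elements of the span of `S`. -/
theorem pow_mul_pow_eq_zero {S : Set A} {X : A} {N : ℕ} (hX : X ^ N = 0)
    (hS : ∀ z ∈ S, Commute z X ∧ ∃ y : A, ∃ c : ℂ, c ≠ 0 ∧ ⁅y, X⁆ = c • z ∧
      ∀ x ∈ S, ⁅y, x⁆ ∈ Submodule.span ℂ S) {r : ℕ} (hr : r ≤ N) :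
    ∀ P ∈ Submodule.span ℂ S ^ r, P * X ^ (N - r) = 0 := by
  induction r with
  | zero => simp [hX]
  | succ r ih =>
    intro P hP
    obtain ⟨s, hs⟩ : ∃ s, N - r = s + 1 := ⟨N - r - 1, by omega⟩
    rw [show N - (r + 1) = s by omega]
    have ih' := ih (by omega)
    rw [hs] at ih'
    rw [pow_succ] at hP
    induction hP using Submodule.mul_induction_on' with
    | add x _ y _ hx hy => rw [add_mul, hx, hy, add_zero]
    | mem_mul_mem P hP z hz =>
      induction hz using Submodule.span_induction with
      | zero => simp
      | add x y _ _ hx hy => rw [mul_add, add_mul, hx, hy, add_zero]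
      | smul c x _ hx => rw [mul_smul_comm, smul_mul_assoc, hx, smul_zero]
      | mem z hz =>
        obtain ⟨hzX, y, c, hc, hy, hyS⟩ := hS z hz
        have h1 : ⁅y, P⁆ * X ^ (s + 1) = 0 :=
          ih' _ (lie_mem_pow le_rfl (fun x hx => lie_mem_of_mem_span hyS hx) hP)
        have h2 := lie_pow_succ hy (hzX.smul_left c) s
        have h3 : ⁅y, P⁆ * X ^ (s + 1) + P * ⁅y, X ^ (s + 1)⁆
            = y * (P * X ^ (s + 1)) - (P * X ^ (s + 1)) * y := by
          simp only [Ring.lie_def]; noncomm_ring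
        rw [ih' P hP, h1, h2, smul_mul_assoc, mul_smul_comm, mul_smul_comm, smul_smul,
          ← mul_assoc] at h3
        simp only [zero_add, mul_zero, zero_mul, sub_zero, smul_eq_zero] at h3
        exact h3.resolve_left (mul_ne_zero (Nat.cast_add_one_ne_zero s) hc)

end Commutators

theorem actList_eq_prod {L V : Type*} [LieRing L] [LieAlgebra ℂ L] [AddCommGroup V] [Module ℂ V]
    [LieRingModule L V] [LieModule ℂ L V] (l : List L) (v : V) :
    actList l v = (l.map (LieModule.toEnd ℂ L V)).prod v := by
  induction l with
  | nil => simp [actList]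
  | cons x l ih => simp [actList, ih]

section MapAlgebra

variable {B : Type} [CommRing B] [Algebra ℂ B]
variable {V : Type} [AddCommGroup V] [Module ℂ V]
  [LieRingModule (B ⊗[ℂ] τ) V] [LieModule ℂ (B ⊗[ℂ] τ) V]

/-- The operator on `V` given by `X ⊗ b`. -/
noncomputable def tensorAct (V : Type) [AddCommGroup V] [Module ℂ V]
    [LieRingModule (B ⊗[ℂ] τ) V] [LieModule ℂ (B ⊗[ℂ] τ) V] (b : B) :
    τ →ₗ[ℂ] Module.End ℂ V :=
  (LieModule.toEnd ℂ (B ⊗[ℂ] τ) V : B ⊗[ℂ] τ →ₗ[ℂ] Module.End ℂ V) ∘ₗ TensorProduct.mk ℂ B τ b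

theorem tensorAct_apply (b : B) (X : τ) (v : V) : tensorAct V b X v = ⁅b ⊗ₜ[ℂ] X, v⁆ := rfl

theorem lie_tensorAct (b c : B) (X Y : τ) :
    ⁅tensorAct V b X, tensorAct V c Y⁆ = tensorAct V (b * c) ⁅X, Y⁆ := by
  ext v
  simp [Ring.lie_def, tensorAct_apply, ← LieAlgebra.ExtendScalars.bracket_tmul]

theorem commute_tensorAct {I : Ideal B} (hann : annTensor τ B (I ^ 2) V) {a b : B}
    (ha : a ∈ I) (hb : b ∈ I) (X Y : τ) :
    Commute (tensorAct V a X) (tensorAct V b Y) := by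
  rw [commute_iff_lie_eq, lie_tensorAct]
  ext v
  exact hann _ _ (by rw [pow_two]; exact Ideal.mul_mem_mul ha hb) v

theorem iterate_lie_eq (b : B) (X : τ) (k : ℕ) (v : V) :
    (fun w : V => ⁅b ⊗ₜ[ℂ] X, w⁆)^[k] v = (tensorAct V b X ^ k) v := by
  rw [Module.End.pow_apply]; rfl

variable {κ : 𝔤 →ₗ[ℂ] 𝔤 →ₗ[ℂ] ℂ} {c₁ c₂ : ℂ}
  {E : (Fin n → ℤ) → 𝔤 →ₗ[ℂ] τ} {K W : (Fin n → ℤ) → Fin n → τ}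

theorem sum_single_smul (i : Fin n) (p : ℤ) (f : Fin n → τ) :
    ∑ q, (((Pi.single i p : Fin n → ℤ) q : ℤ) : ℂ) • f q = (p : ℂ) • f i := by
  rw [Finset.sum_eq_single i]
  · simp
  · intro b _ hb; simp [hb]
  · simp

theorem IsFullToroidal.lie_mem_span_K (hτ : IsFullToroidal n 𝔤 τ κ c₁ c₂ E K W) (X : τ)
    (m : Fin n → ℤ) (j : Fin n) :
    ⁅X, K m j⁆ ∈ Submodule.span ℂ {z | ∃ m j, z = K m j} := by
  have hK : ∀ m j, K m j ∈ Submodule.span ℂ {z | ∃ m j, z = K m j} :=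
    fun m j => Submodule.subset_span ⟨m, j, rfl⟩
  have hX : X ∈ Submodule.span ℂ ({z : τ | ∃ m x, z = E m x} ∪ {z : τ | ∃ m i, z = K m i} ∪
        {z : τ | ∃ m i, z = W m i}) := by rw [hτ.span_eq_top]; trivial
  induction hX using Submodule.span_induction with
  | zero => simp
  | add x z _ _ hx hz => rw [add_lie]; exact add_mem hx hz
  | smul c x _ hx => rw [smul_lie]; exact Submodule.smul_mem _ c hx
  | mem x hx =>
    rcases hx with (⟨k, x, rfl⟩ | ⟨k, l, rfl⟩) | ⟨k, l, rfl⟩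
    · rw [hτ.lie_E_K]; exact zero_mem _
    · rw [hτ.lie_K_K]; exact zero_mem _
    · rw [hτ.lie_W_K]
      refine add_mem (Submodule.smul_mem _ _ (hK _ _)) ?_
      split_ifs
      · exact sum_mem fun q _ => Submodule.smul_mem _ _ (hK _ _)
      · exact zero_mem _

/-- The operators `t^m K_j ⊗ ab` with `|m_i| < q`, excluding those with `j = i` and `m_i = 0`. -/
def kahlerOps (V : Type) [AddCommGroup V] [Module ℂ V]
    [LieRingModule (B ⊗[ℂ] τ) V] [LieModule ℂ (B ⊗[ℂ] τ) V]
    (K : (Fin n → ℤ) → Fin n → τ) (a : B) (i : Fin n) (q : ℤ) : Set (Module.End ℂ V) :=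
  {z | ∃ (m : Fin n → ℤ) (j : Fin n) (b : B),
    |m i| < q ∧ (j ≠ i ∨ m i ≠ 0) ∧ z = tensorAct V (a * b) (K m j)}

theorem kahlerOps_mono {a : B} {i : Fin n} {q q' : ℤ} (h : q ≤ q') :
    kahlerOps V K a i q ⊆ kahlerOps V K a i q' := by
  rintro _ ⟨m, j, b, hm, hj, rfl⟩
  exact ⟨m, j, b, hm.trans_le h, hj, rfl⟩

theorem IsFullToroidal.kahlerOps_pow_eq_zero (hτ : IsFullToroidal n 𝔤 τ κ c₁ c₂ E K W)
    {I : Ideal B} (hann : annTensor τ B (I ^ 2) V) {a : B} (ha : a ∈ I) {i : Fin n} {N : ℕ}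
    {q : ℤ} (hd : tensorAct V a (W (Pi.single i q) i) ^ N = 0)
    {P : Module.End ℂ V} (hP : P ∈ Submodule.span ℂ (kahlerOps V K a i q) ^ N) : P = 0 := by
  have key := pow_mul_pow_eq_zero (S := kahlerOps V K a i q) hd ?_ le_rfl P hP
  · simpa using key
  rintro _ ⟨m, j, b, hm, hj, rfl⟩
  refine ⟨commute_tensorAct hann (I.mul_mem_right b ha) ha _ _,
    tensorAct V b (K (m - Pi.single i q) j), if j = i then -(m i : ℂ) else -((m i : ℂ) - q),
    ?_, ?_, ?_⟩
  · split_ifs with h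
    · have := hj.resolve_left (not_not.2 h)
      exact neg_ne_zero.2 (Int.cast_ne_zero.2 this)
    · have : m i - q ≠ 0 := by have := (abs_lt.1 hm).2; omega
      exact neg_ne_zero.2 (by exact_mod_cast this)
  · rw [lie_tensorAct, ← lie_skew, hτ.lie_W_K, mul_comm b a, add_sub_cancel, sum_single_smul,
      ← map_smul]
    congr 1
    by_cases h : j = i
    · subst h
      simp
      module
    · simp [h, Ne.symm h]
      module
  · rintro _ ⟨k, l, b', -, -, rfl⟩
    rw [lie_tensorAct, hτ.lie_K_K, map_zero]
    exact zero_mem _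

theorem IsFullToroidal.mul_eq_zero_of_kahlerOps (hτ : IsFullToroidal n 𝔤 τ κ c₁ c₂ E K W)
    {a : B} {i j : Fin n} (hij : j ≠ i) {s : ℕ}
    (hs : ∀ q : ℤ, 0 < q → ∀ P ∈ Submodule.span ℂ (kahlerOps V K a i q) ^ (s + 1), P = 0)
    {q : ℤ} (hq : 0 < q) {Q : Module.End ℂ V}
    (hQ : Q ∈ Submodule.span ℂ (kahlerOps V K a i q) ^ s) (m : Fin n → ℤ) (l : Fin n) (b : B) :
    tensorAct V (a * b) (K m l) * Q = 0 := by
  have good : ∀ (m : Fin n → ℤ) (l : Fin n) (b : B), (l ≠ i ∨ m i ≠ 0) →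
      tensorAct V (a * b) (K m l) * Q = 0 := by
    intro m l b hl
    refine hs (max q (|m i| + 1)) (lt_max_of_lt_left hq) _ ?_
    exact mul_mem_pow_succ_s13
      (Submodule.subset_span ⟨m, l, b, lt_max_of_lt_right (lt_add_one _), hl, rfl⟩)
      (pow_le_pow_left' (Submodule.span_mono (kahlerOps_mono (le_max_left _ _))) s hQ)
  by_cases hl : l ≠ i ∨ m i ≠ 0
  · exact good m l b hl
  obtain ⟨rfl, hm⟩ : l = i ∧ m i = 0 := by simpa [not_or] using hl
  set y := tensorAct V (1 : B) (W (Pi.single l (-2 * q)) j) with hy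
  have hyK : ∀ (k : Fin n → ℤ) (p : Fin n) (c : B), ⁅y, tensorAct V (a * c) (K k p)⁆
      = (k j : ℂ) • tensorAct V (a * c) (K (Pi.single l (-2 * q) + k) p)
        + (if j = p then ((-2 * q : ℤ) : ℂ) else 0) •
          tensorAct V (a * c) (K (Pi.single l (-2 * q) + k) l) := by
    intro k p c
    rw [hy, lie_tensorAct, hτ.lie_W_K, one_mul, sum_single_smul, map_add, map_smul]
    split_ifs <;> simp
  have hyQ : ⁅y, Q⁆ ∈ Submodule.span ℂ (kahlerOps V K a l (3 * q)) ^ s := by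
    refine lie_mem_pow (Submodule.span_mono (kahlerOps_mono (by omega))) (fun x hx =>
      lie_mem_of_mem_span ?_ hx) hQ
    rintro _ ⟨k, p, c, hk, -, rfl⟩
    have hk' := abs_lt.1 hk
    have mem : ∀ p, tensorAct V (a * c) (K (Pi.single l (-2 * q) + k) p) ∈
        Submodule.span ℂ (kahlerOps V K a l (3 * q)) := fun p =>
      Submodule.subset_span ⟨_, p, c, by
        rw [abs_lt]; simp only [Pi.add_apply, Pi.single_eq_same]; omega, Or.inr (by
        simp only [Pi.add_apply, Pi.single_eq_same]; omega), rfl⟩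
    rw [hyK]
    exact add_mem (Submodule.smul_mem _ _ (mem p)) (Submodule.smul_mem _ _ (mem l))
  set k : Fin n → ℤ := m - Pi.single l (-2 * q) with hk
  have hkl : k l = 2 * q := by simp [hk, hm]
  set g := tensorAct V (a * b) (K k j) with hg
  have hgQ : g * Q = 0 := good k j b (Or.inl hij)
  have hgyQ : g * ⁅y, Q⁆ = 0 := by
    refine hs (3 * q) (by omega) _ ?_
    exact mul_mem_pow_succ_s13 (Submodule.subset_span
      ⟨k, j, b, by rw [hkl, abs_lt]; omega, Or.inl hij, rfl⟩) hyQ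
  have e : ⁅y, g⁆ * Q = y * (g * Q) - (g * Q) * y - g * ⁅y, Q⁆ := by
    simp only [Ring.lie_def]; noncomm_ring
  rw [hgQ, hgyQ, hyK, hk, add_sub_cancel, add_mul, smul_mul_assoc, smul_mul_assoc,
    good m j b (Or.inl hij)] at e
  have hq2 : ((-2 * q : ℤ) : ℂ) ≠ 0 := Int.cast_ne_zero.2 (by omega)
  simpa [hq2, hq.ne'] using e

/-- The vectors annihilated by `𝒦 ⊗ aB` form a submodule. -/
def IsFullToroidal.kahlerKer (hτ : IsFullToroidal n 𝔤 τ κ c₁ c₂ E K W) (V : Type)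
    [AddCommGroup V] [Module ℂ V] [LieRingModule (B ⊗[ℂ] τ) V] [LieModule ℂ (B ⊗[ℂ] τ) V]
    (a : B) : LieSubmodule ℂ (B ⊗[ℂ] τ) V where
  carrier := {v | ∀ m j b, tensorAct V (a * b) (K m j) v = 0}
  add_mem' := fun hx hy m j b => by rw [map_add, hx, hy, add_zero]
  zero_mem' := fun m j b => map_zero _
  smul_mem' := fun c x hx m j b => by rw [map_smul, hx, smul_zero]
  lie_mem := by
    intro x v hv m j b
    have hspan : ∀ Z ∈ Submodule.span ℂ {z | ∃ m j, z = K m j}, ∀ b,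
        tensorAct V (a * b) Z v = 0 := by
      intro Z hZ b
      induction hZ using Submodule.span_induction with
      | zero => simp
      | add x z _ _ hx hz => rw [map_add, LinearMap.add_apply, hx, hz, add_zero]
      | smul c x _ hx => rw [map_smul, LinearMap.smul_apply, hx, smul_zero]
      | mem x hx => obtain ⟨m, j, rfl⟩ := hx; exact hv m j b
    induction x using TensorProduct.induction_on with
    | zero => simp
    | add x y hx hy => rw [add_lie, map_add, hx, hy, add_zero]
    | tmul c X =>
      have h : ⁅tensorAct V c X, tensorAct V (a * b) (K m j)⁆ v = 0 := by
        rw [lie_tensorAct, mul_left_comm]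
        exact hspan _ (hτ.lie_mem_span_K X m j) _
      rw [Ring.lie_def, LinearMap.sub_apply, Module.End.mul_apply, Module.End.mul_apply,
        hv, map_zero, zero_sub, neg_eq_zero] at h
      exact h

theorem IsFullToroidal.tensorAct_K_eq_zero (hτ : IsFullToroidal n 𝔤 τ κ c₁ c₂ E K W)
    (hirr : LieModule.IsIrreducible ℂ (B ⊗[ℂ] τ) V) {I : Ideal B}
    (hann : annTensor τ B (I ^ 2) V) {a : B} (ha : a ∈ I) {i j : Fin n} (hij : j ≠ i) {N : ℕ}
    (hd : ∀ p : ℤ, tensorAct V a (W (Pi.single i p) i) ^ N = 0) (m : Fin n → ℤ) (l : Fin n) :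
    tensorAct V a (K m l) = 0 := by
  suffices h : hτ.kahlerKer V a = ⊤ by
    ext v
    have hv : v ∈ hτ.kahlerKer V a := by rw [h]; trivial
    simpa using hv m l 1
  refine (eq_bot_or_eq_top _).resolve_left fun hbot => ?_
  have hex : ∃ r, ∀ q : ℤ, 0 < q →
      ∀ P ∈ Submodule.span ℂ (kahlerOps V K a i q) ^ r, P = 0 :=
    ⟨N, fun q _ P hP => hτ.kahlerOps_pow_eq_zero hann ha (hd q) hP⟩
  classical
  obtain ⟨s, hs, hmin⟩ : ∃ s, (∀ q : ℤ, 0 < q →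
      ∀ P ∈ Submodule.span ℂ (kahlerOps V K a i q) ^ (s + 1), P = 0) ∧
      ¬ ∀ q : ℤ, 0 < q → ∀ P ∈ Submodule.span ℂ (kahlerOps V K a i q) ^ s, P = 0 := by
    rcases h : Nat.find hex with _ | s
    · have h1 := Nat.find_spec hex
      rw [h] at h1
      have h2 : (1 : Module.End ℂ V) = 0 := h1 1 one_pos 1 (one_mem_pow_zero_s13 _)
      have : Nontrivial V := (LieSubmodule.nontrivial_iff ℂ (B ⊗[ℂ] τ) V).1 inferInstance
      exact absurd h2 one_ne_zero
    · have h1 := Nat.find_spec hex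
      rw [h] at h1
      exact ⟨s, h1, Nat.find_min hex (by omega)⟩
  push Not at hmin
  obtain ⟨q, hq, Q, hQ, hQ0⟩ := hmin
  refine hQ0 (LinearMap.ext fun v => ?_)
  have hv : Q v ∈ hτ.kahlerKer V a := fun m l b =>
    LinearMap.congr_fun (hτ.mul_eq_zero_of_kahlerOps hij hs hq hQ m l b) v
  rw [hbot] at hv
  simpa using hv

/-- The operators `t^m d_i ⊗ a` with `m_i < p`. -/
def wittOps (V : Type) [AddCommGroup V] [Module ℂ V]
    [LieRingModule (B ⊗[ℂ] τ) V] [LieModule ℂ (B ⊗[ℂ] τ) V]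
    (W : (Fin n → ℤ) → Fin n → τ) (a : B) (i : Fin n) (p : ℤ) : Set (Module.End ℂ V) :=
  {z | ∃ m : Fin n → ℤ, m i < p ∧ z = tensorAct V a (W m i)}

theorem IsFullToroidal.wittOps_pow_eq_zero (hτ : IsFullToroidal n 𝔤 τ κ c₁ c₂ E K W)
    {I : Ideal B} (hann : annTensor τ B (I ^ 2) V) {a : B} (ha : a ∈ I) {i : Fin n} {N : ℕ}
    (hK : ∀ m l, tensorAct V a (K m l) = 0) {p : ℤ} (hp : 0 < p)
    (hd : tensorAct V a (W (Pi.single i p) i) ^ N = 0)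
    {P : Module.End ℂ V} (hP : P ∈ Submodule.span ℂ (wittOps V W a i p) ^ N) : P = 0 := by
  have hWW : ∀ k m : Fin n → ℤ, ⁅tensorAct V (1 : B) (W k i), tensorAct V a (W m i)⁆
      = ((m i : ℂ) - k i) • tensorAct V a (W (k + m) i) := by
    intro k m
    rw [lie_tensorAct, hτ.lie_W_W, one_mul]
    simp [hK, sub_smul]
  have key := pow_mul_pow_eq_zero (S := wittOps V W a i p) hd ?_ le_rfl P hP
  · simpa using key
  rintro _ ⟨m, hm, rfl⟩
  refine ⟨commute_tensorAct hann ha ha _ _, tensorAct V (1 : B) (W (m - Pi.single i p) i),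
    2 * p - m i, ?_, ?_, ?_⟩
  · have : 2 * p - m i ≠ 0 := by omega
    exact_mod_cast this
  · rw [hWW, sub_add_cancel]
    simp
    ring_nf
  · rintro _ ⟨k, hk, rfl⟩
    rw [hWW]
    refine Submodule.smul_mem _ _ (Submodule.subset_span ⟨_, ?_, rfl⟩)
    simp only [Pi.add_apply, Pi.sub_apply, Pi.single_eq_same]
    omega

end MapAlgebra

theorem statement_13
    (n : ℕ) (hn : 3 ≤ n)
    (𝔤 : Type) [LieRing 𝔤] [LieAlgebra ℂ 𝔤] [LieAlgebra.IsSimple ℂ 𝔤]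
    [FiniteDimensional ℂ 𝔤]
    (τ : Type) [LieRing τ] [LieAlgebra ℂ τ]
    (κ : 𝔤 →ₗ[ℂ] 𝔤 →ₗ[ℂ] ℂ) (c₁ c₂ : ℂ)
    (E : (Fin n → ℤ) → 𝔤 →ₗ[ℂ] τ) (K W : (Fin n → ℤ) → Fin n → τ)
    (hτ : IsFullToroidal n 𝔤 τ κ c₁ c₂ E K W)
    (B : Type) [CommRing B] [Algebra ℂ B] [Nontrivial B]
    (hB : Algebra.FiniteType ℂ B)
    (V : Type) [AddCommGroup V] [Module ℂ V]
    [LieRingModule (B ⊗[ℂ] τ) V] [LieModule ℂ (B ⊗[ℂ] τ) V]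
    (hirr : LieModule.IsIrreducible ℂ (B ⊗[ℂ] τ) V)
    (hcusp : IsCuspidal (V := V) (dOp B W))
    (𝔐 : Ideal B) (hann : annTensor τ B (𝔐 ^ 2) V)
    (i : Fin n) (N : ℕ)
    (hd : ∀ p : ℤ, ∀ a ∈ 𝔐, ∀ v : V,
      (fun w : V => ⁅a ⊗ₜ[ℂ] W (Pi.single i p) i, w⁆)^[N] v = 0) :
    ∀ r : ℕ, r ≤ N → ∀ a ∈ 𝔐, ∀ ms : Fin r → (Fin n → ℤ), ∀ p : ℤ,
      (∀ j : Fin r, ms j i < p) → ∀ v : V,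
        actList (List.ofFn fun j => a ⊗ₜ[ℂ] W (ms j) i)
          ((fun w : V => ⁅a ⊗ₜ[ℂ] W (Pi.single i p) i, w⁆)^[N - r] v) = 0 := by
  intro r hr a ha ms p hms v
  obtain ⟨j, hij⟩ : ∃ j : Fin n, j ≠ i := by
    have : Nontrivial (Fin n) := Fin.nontrivial_iff_two_le.2 (by omega)
    exact exists_ne i
  have hd' : ∀ p : ℤ, tensorAct V a (W (Pi.single i p) i) ^ N = 0 := fun p =>
    LinearMap.ext fun v => by rw [← iterate_lie_eq, hd p a ha v]; rfl
  have hK := hτ.tensorAct_K_eq_zero hirr hann ha hij hd'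
  rw [iterate_lie_eq, actList_eq_prod, ← Module.End.mul_apply]
  set q := max p 0 + 1
  have hmem : ∀ m : Fin n → ℤ, m i ≤ p →
      tensorAct V a (W m i) ∈ Submodule.span ℂ (wittOps V W a i q) := fun m hm =>
    Submodule.subset_span ⟨m, by omega, rfl⟩
  have hprod : ((List.ofFn fun j => a ⊗ₜ[ℂ] W (ms j) i).map
      (LieModule.toEnd ℂ (B ⊗[ℂ] τ) V)).prod ∈ Submodule.span ℂ (wittOps V W a i q) ^ r := by
    rw [List.map_ofFn]
    clear hr
    induction r with
    | zero => simpa only [List.ofFn_zero, List.prod_nil] using one_mem_pow_zero_s13 _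
    | succ r ih =>
      rw [List.ofFn_succ, List.prod_cons]
      exact mul_mem_pow_succ_s13 (hmem _ (hms 0).le) (ih (fun j => ms j.succ) fun j => hms _)
  have hP := mul_pow_mem_pow hr hprod (hmem (Pi.single i p) (by simp))
  rw [hτ.wittOps_pow_eq_zero hann ha hK (by omega) (hd' q) hP, LinearMap.zero_apply]

end MT
end
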